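/- arXiv:2209.01201 — 2 statements merged into one kernel-verified Lean document; each statement's English description precedes it below -/
import Mathlib

section
/- Let G be a finite simple graph on the vertex set [n] and K a field. Then reg(S/J_G) ≤ η(G), where η(G) is the maximum cardinality of a clique disjoint edge set in G. In particular, since η(G) ≤ c(G), this proves the Saeedi Madani–Kiani conjecture reg(S/J_G) ≤ c(G), where c(G) is the number of maximal cliques of G. -/
open MvPolynomial

noncomputable section

/-- The binomial edge ideal of a simple graph `G` on vertex set `V`, inside
`K[x_v, y_v : v ∈ V] = MvPolynomial (V ⊕ V) K`. -/
def binomialEdgeIdeal (K : Type) [Field K] {V : Type} (G : SimpleGraph V) :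
    Ideal (MvPolynomial (V ⊕ V) K) :=
  Ideal.span {f | ∃ i j, G.Adj i j ∧
    f = X (Sum.inl i) * X (Sum.inr j) - X (Sum.inl j) * X (Sum.inr i)}

/-- A minimal graded free resolution of the quotient `S/I`,
`⋯ → F₁ → F₀ → S/I → 0`, recorded concretely:
`F i = ⊕_e S(- twist i e)`, the augmentation `F 0 → S/I` sends the `e`-th
basis vector to the class of the homogeneous polynomial `gen e`, the
differentials are matrices with homogeneous entries, the complex is exact,
eventually vanishes, and all entries of all differentials lie in the graded
maximal ideal. -/
structure MinimalGradedFreeResolutionOfQuotient {σ K : Type} [Field K]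
    (I : Ideal (MvPolynomial σ K)) where
  rank : ℕ → ℕ
  twist : (i : ℕ) → Fin (rank i) → ℕ
  gen : Fin (rank 0) → MvPolynomial σ K
  diff : (i : ℕ) → Matrix (Fin (rank i)) (Fin (rank (i + 1))) (MvPolynomial σ K)
  gen_homog : ∀ e, (gen e).IsHomogeneous (twist 0 e)
  gen_span : ∀ g : MvPolynomial σ K,
    ∃ c : Fin (rank 0) → MvPolynomial σ K, g - ∑ e, c e * gen e ∈ I
  diff_homog : ∀ i r c, diff i r c = 0 ∨
    (twist i r ≤ twist (i + 1) c ∧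
      (diff i r c).IsHomogeneous (twist (i + 1) c - twist i r))
  minimal : ∀ i r c, constantCoeff (diff i r c) = 0
  exact_zero : ∀ v : Fin (rank 0) → MvPolynomial σ K,
    (∑ e, v e * gen e ∈ I) ↔ ∃ w, v = (diff 0).mulVec w
  exact_succ : ∀ i (v : Fin (rank (i + 1)) → MvPolynomial σ K),
    (diff i).mulVec v = 0 ↔ ∃ w, v = (diff (i + 1)).mulVec w
  fin_length : ∃ N, ∀ i, N ≤ i → rank i = 0

/-- Castelnuovo–Mumford regularity read off from a minimal graded free
resolution: `reg = max { j - i : β_{i,j} ≠ 0 }`. -/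
def MinimalGradedFreeResolutionOfQuotient.reg {σ K : Type} [Field K]
    {I : Ideal (MvPolynomial σ K)}
    (F : MinimalGradedFreeResolutionOfQuotient I) : ℕ :=
  sSup {d : ℕ | ∃ i e, F.twist i e = d + i}

/-- A set of edges of `G` is clique disjoint if no two of its elements are
contained in a common clique of `G`. -/
def IsCliqueDisjointEdgeSet {V : Type} (G : SimpleGraph V)
    (H : Finset (Sym2 V)) : Prop :=
  ↑H ⊆ G.edgeSet ∧
    ∀ e₁ ∈ H, ∀ e₂ ∈ H, e₁ ≠ e₂ →
      ¬ ∃ C : Set V, G.IsClique C ∧ (∀ v ∈ e₁, v ∈ C) ∧ ∀ v ∈ e₂, v ∈ C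

/-- `η(G)`: the maximal cardinality of a clique disjoint edge set in `G`. -/
def eta {V : Type} (G : SimpleGraph V) : ℕ :=
  sSup {k : ℕ | ∃ H : Finset (Sym2 V), IsCliqueDisjointEdgeSet G H ∧ H.card = k}

/-- `c(G)`: the number of maximal cliques of `G`. -/
def maximalCliqueCount {V : Type} (G : SimpleGraph V) : ℕ :=
  Set.ncard {C : Finset V | Maximal (fun D : Finset V => G.IsClique ↑D) C}

set_option linter.unusedSectionVars false

namespace BEI

section Koszul

variable {σ K : Type} [Fintype σ] [DecidableEq σ] [Field K]

/-- Koszul sign. -/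
def sg (K : Type) [Field K] (s : σ) (T : Finset σ) : MvPolynomial σ K :=
  (-1) ^ (T.filter (fun t => Fintype.equivFin σ t < Fintype.equivFin σ s)).card

theorem sg_mul_self (s : σ) (T : Finset σ) : sg K s T * sg K s T = 1 := by
  unfold sg
  rw [← pow_add, ← two_mul, pow_mul]; simp

theorem sg_insert_self (s : σ) (T : Finset σ) : sg K s (insert s T) = sg K s T := by
  unfold sg
  rw [Finset.filter_insert]; simp

theorem sg_insert_lt {s t : σ} {T : Finset σ} (ht : t ∉ T)
    (h : Fintype.equivFin σ t < Fintype.equivFin σ s) :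
    sg K s (insert t T) = - sg K s T := by
  unfold sg
  rw [Finset.filter_insert, if_pos h, Finset.card_insert_of_notMem (by simp [ht]), pow_succ]
  ring

theorem sg_insert_not_lt {s t : σ} {T : Finset σ}
    (h : ¬ Fintype.equivFin σ t < Fintype.equivFin σ s) :
    sg K s (insert t T) = sg K s T := by
  unfold sg
  rw [Finset.filter_insert, if_neg h]

/-- key sign identity -/
theorem sg_anti {s t : σ} {T : Finset σ} (hst : s ≠ t) (hs : s ∉ T) (ht : t ∉ T) :
    sg K s T * sg K t (insert s T) = - (sg K t T * sg K s (insert t T)) := by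
  have hne : Fintype.equivFin σ s ≠ Fintype.equivFin σ t := by simpa using hst
  rcases lt_or_gt_of_ne hne with h | h
  · rw [sg_insert_lt hs h, sg_insert_not_lt (not_lt.2 h.le)]; ring
  · rw [sg_insert_lt ht h, sg_insert_not_lt (not_lt.2 h.le)]; ring

/-- Koszul differential. -/
def kd : (Finset σ → MvPolynomial σ K) →ₗ[MvPolynomial σ K] (Finset σ → MvPolynomial σ K) where
  toFun z := fun T => ∑ s, if s ∈ T then 0 else sg K s T * X s * z (insert s T)
  map_add' z w := by
    funext T
    simp only [Pi.add_apply, ← Finset.sum_add_distrib]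
    refine Finset.sum_congr rfl fun s _ => ?_
    split_ifs
    · simp
    · ring
  map_smul' a z := by
    funext T
    simp only [Pi.smul_apply, smul_eq_mul, RingHom.id_apply, Finset.mul_sum]
    refine Finset.sum_congr rfl fun s _ => ?_
    split_ifs
    · simp
    · ring

theorem kd_apply (z : Finset σ → MvPolynomial σ K) (T : Finset σ) :
    kd z T = ∑ s, if s ∈ T then 0 else sg K s T * X s * z (insert s T) := rfl

theorem kd_kd (z : Finset σ → MvPolynomial σ K) : kd (kd z) = 0 := by
  funext T
  have h1 : kd (kd z) T = ∑ s, ∑ t, if s ∈ T ∨ t ∈ insert s T then 0 else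
      sg K s T * sg K t (insert s T) * (X s * X t * z (insert t (insert s T))) := by
    rw [kd_apply]
    refine Finset.sum_congr rfl fun s _ => ?_
    split_ifs with h
    · simp [h]
    · rw [kd_apply, Finset.mul_sum]
      refine Finset.sum_congr rfl fun t _ => ?_
      by_cases h2 : t ∈ insert s T
      · simp [h2]
      · simp only [h2, if_false, h, or_self]; ring
  rw [h1]
  simp only [Pi.zero_apply, ← Finset.sum_product']
  refine Finset.sum_involution (fun p _ => (p.2, p.1)) ?_ ?_ ?_ ?_
  · rintro ⟨s, t⟩ -
    by_cases hs : s ∈ T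
    · simp [hs]
    by_cases ht : t ∈ T
    · simp [ht]
    by_cases hst : s = t
    · subst hst; simp
    have hts : t ≠ s := Ne.symm hst
    simp only [Finset.mem_insert, hs, ht, hst, hts, or_self, if_false]
    rw [sg_anti hst hs ht, Finset.insert_comm s t]
    ring
  · rintro ⟨s, t⟩ - h heq
    simp only [Prod.mk.injEq] at heq
    apply h
    rw [heq.1]; simp
  · simp
  · simp

/-- exterior multiplication -/
def ke (v : σ) (b : Finset σ → MvPolynomial σ K) : Finset σ → MvPolynomial σ K :=
  fun T => if v ∈ T then sg K v T * b (T.erase v) else 0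

theorem kd_ke (v : σ) (b : Finset σ → MvPolynomial σ K) :
    kd (ke v b) + ke v (kd b) = fun T => X v * b T := by
  funext T
  rw [Pi.add_apply]
  by_cases hv : v ∈ T
  · obtain ⟨T', hT', rfl⟩ : ∃ T', v ∉ T' ∧ T = insert v T' :=
      ⟨T.erase v, by simp, by simp [Finset.insert_erase hv]⟩
    have h2 : ke v (kd b) (insert v T') = ∑ s, if s ∈ T' then 0 else
        sg K v T' * sg K s T' * (X s * b (insert s T')) := by
      simp only [ke, Finset.mem_insert_self, if_true, Finset.erase_insert hT', kd_apply,
        Finset.mul_sum, sg_insert_self]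
      refine Finset.sum_congr rfl fun s _ => ?_
      split_ifs
      · simp
      · ring
    rw [h2, kd_apply, ← Finset.sum_add_distrib, Finset.sum_eq_single v]
    · simp only [Finset.mem_insert_self, if_true, hT', if_false, sg_mul_self]; ring
    · intro s _ hsv
      by_cases hs : s ∈ T'
      · simp [hs]
      · have h3 : s ∉ insert v T' := by simp [hs, hsv]
        have h4 : (insert s (insert v T')).erase v = insert s T' := by
          ext t; simp only [Finset.mem_erase, Finset.mem_insert]
          constructor
          · tauto
          · rintro (rfl | h)
            · exact ⟨hsv, Or.inl rfl⟩
            · exact ⟨fun h' => hT' (h' ▸ h), Or.inr (Or.inr h)⟩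
        simp only [h3, hs, if_false, ke, Finset.mem_insert, true_or, or_true, if_true, h4]
        rw [Finset.insert_comm s v, sg_insert_self]
        have := sg_anti (K := K) hsv hs hT'
        linear_combination (X s * b (insert s T')) * (sg K s T' * sg K s (insert v T')) * this
          - (X s * b (insert s T')) * (sg K s (insert v T') * sg K v (insert s T')) *
            sg_mul_self (K := K) s T'
          - (X s * b (insert s T')) * (sg K s T' * sg K v T') *
            sg_mul_self (K := K) s (insert v T')
    · simp
  · rw [kd_apply, Finset.sum_eq_single v]
    · simp only [hv, if_false, ke, Finset.mem_insert_self, if_true, sg_insert_self,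
        Finset.erase_insert hv]
      linear_combination X v * b T * sg_mul_self (K := K) v T
    · intro s _ hsv
      have : v ∉ insert s T := by simp [hv, Ne.symm hsv]
      simp [ke, this]
    · simp

end Koszul

section Reg

variable {σ K : Type} [Fintype σ] [DecidableEq σ] [Field K]

/-- closed under homogeneous components -/
def HomI (I : Ideal (MvPolynomial σ K)) : Prop :=
  ∀ f ∈ I, ∀ k, homogeneousComponent k f ∈ I

theorem homI_span {s : Set (MvPolynomial σ K)} (h : ∀ f ∈ s, ∃ k, f.IsHomogeneous k) :
    HomI (Ideal.span s) := by
  let _ := gradedAlgebra (σ := σ) (R := K)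
  have h1 : (Ideal.span s).IsHomogeneous (homogeneousSubmodule σ K) := by
    apply Ideal.homogeneous_span
    intro f hf
    obtain ⟨k, hk⟩ := h f hf
    exact ⟨k, hk⟩
  intro f hf k
  have := h1 k hf
  rwa [← decomposition.decompose'_apply]

theorem homI_inf {A B : Ideal (MvPolynomial σ K)} (hA : HomI A) (hB : HomI B) : HomI (A ⊓ B) :=
  fun f hf k => ⟨hA f hf.1 k, hB f hf.2 k⟩

theorem homI_sup {A B : Ideal (MvPolynomial σ K)} (hA : HomI A) (hB : HomI B) : HomI (A ⊔ B) := by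
  intro f hf k
  obtain ⟨a, ha, b, hb, rfl⟩ := Submodule.mem_sup.1 hf
  rw [map_add]
  exact Submodule.add_mem_sup (hA a ha k) (hB b hb k)

theorem homComp_X_mul (s : σ) (f : MvPolynomial σ K) (k : ℕ) :
    homogeneousComponent (k + 1) (X s * f) = X s * homogeneousComponent k f := by
  ext m
  rw [coeff_homogeneousComponent, coeff_X_mul', coeff_X_mul', coeff_homogeneousComponent]
  by_cases h : s ∈ m.support
  · have h1 : m.degree = (m - Finsupp.single s 1).degree + 1 := by
      have : m = (m - Finsupp.single s 1) + Finsupp.single s 1 := by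
        ext t
        by_cases ht : s = t
        · subst ht
          have := Finsupp.mem_support_iff.1 h
          simp; omega
        · simp [ht]
      conv_lhs => rw [this]
      simp
    simp only [h, if_true, h1, Nat.add_right_cancel_iff]
  · simp [h]

theorem homComp_sg_mul (s : σ) (T : Finset σ) (f : MvPolynomial σ K) (k : ℕ) :
    homogeneousComponent k (sg K s T * f) = sg K s T * homogeneousComponent k f := by
  unfold sg
  rcases neg_one_pow_eq_or (MvPolynomial σ K)
    (T.filter (fun t => Fintype.equivFin σ t < Fintype.equivFin σ s)).card with h | h <;>
  simp [h]

theorem homComp_kd (w : Finset σ → MvPolynomial σ K) (k : ℕ) (T : Finset σ) :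
    homogeneousComponent (k + 1) (kd w T) = kd (fun T => homogeneousComponent k (w T)) T := by
  rw [kd_apply, kd_apply, map_sum]
  refine Finset.sum_congr rfl fun s _ => ?_
  split_ifs
  · simp
  · rw [mul_assoc, homComp_sg_mul, homComp_X_mul, mul_assoc]

theorem kd_mem {I : Ideal (MvPolynomial σ K)} {z : Finset σ → MvPolynomial σ K}
    (h : ∀ T, z T ∈ I) (T : Finset σ) : kd z T ∈ I := by
  rw [kd_apply]
  refine Ideal.sum_mem _ fun s _ => ?_
  split_ifs
  · exact zero_mem _
  · exact Ideal.mul_mem_left _ _ (h _)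

theorem ke_mem {I : Ideal (MvPolynomial σ K)} {z : Finset σ → MvPolynomial σ K}
    (h : ∀ T, z T ∈ I) (v : σ) (T : Finset σ) : ke v z T ∈ I := by
  unfold ke
  split_ifs
  · exact Ideal.mul_mem_left _ _ (h _)
  · exact zero_mem _

theorem kd_hom {d : ℕ} {w : Finset σ → MvPolynomial σ K}
    (h : ∀ T, (w T).IsHomogeneous d) (T : Finset σ) : (kd w T).IsHomogeneous (d + 1) := by
  have h1 : (fun T => homogeneousComponent d (w T)) = w := by
    funext T; rw [homogeneousComponent_of_mem (h T)]; simp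
  have := homComp_kd w d T
  rw [h1] at this
  rw [← this]
  exact homogeneousComponent_isHomogeneous _ _

/-- Regularity of `S/I` at most `r`, via strands of the Koszul complex. -/
def RegLE (I : Ideal (MvPolynomial σ K)) (r : ℕ) : Prop :=
  ∀ d, r ≤ d → ∀ z : Finset σ → MvPolynomial σ K, (∀ T, (z T).IsHomogeneous (d + 1)) →
    (∀ T, kd z T ∈ I) →
    ∃ w : Finset σ → MvPolynomial σ K, (∀ T, (w T).IsHomogeneous d) ∧ ∀ T, z T - kd w T ∈ I

theorem RegLE.mono {I : Ideal (MvPolynomial σ K)} {r r' : ℕ} (h : RegLE I r) (hr : r ≤ r') :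
    RegLE I r' := fun d hd => h d (hr.trans hd)

theorem RegLE.of_weak {I : Ideal (MvPolynomial σ K)} {r : ℕ} (hI : HomI I)
    (h : ∀ d, r ≤ d → ∀ z : Finset σ → MvPolynomial σ K, (∀ T, (z T).IsHomogeneous (d + 1)) →
    (∀ T, kd z T ∈ I) →
    ∃ w : Finset σ → MvPolynomial σ K, ∀ T, z T - kd w T ∈ I) : RegLE I r := by
  intro d hd z hz hz'
  obtain ⟨w, hw⟩ := h d hd z hz hz'
  refine ⟨fun T => homogeneousComponent d (w T), fun T => homogeneousComponent_isHomogeneous _ _,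
    fun T => ?_⟩
  have := hI _ (hw T) (d + 1)
  rwa [map_sub, homComp_kd, homogeneousComponent_of_mem (hz T), if_pos rfl] at this

theorem RegLE.inf {A B : Ideal (MvPolynomial σ K)} {r r' : ℕ} (hA : HomI A) (hB : HomI B)
    (h1 : RegLE A r) (h2 : RegLE B r) (h3 : RegLE (A ⊔ B) r') (hr : r' + 1 ≤ r) :
    RegLE (A ⊓ B) r := by
  refine RegLE.of_weak (homI_inf hA hB) fun d hd z hz hz' => ?_
  obtain ⟨wa, ha, ha'⟩ := h1 d hd z hz (fun T => (hz' T).1)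
  obtain ⟨wb, hb, hb'⟩ := h2 d hd z hz (fun T => (hz' T).2)
  obtain ⟨d, rfl⟩ : ∃ d', d = d' + 1 := ⟨d - 1, by omega⟩
  obtain ⟨u, hu, hu'⟩ := h3 d (by omega) (wa - wb) (fun T => (ha T).sub (hb T)) (fun T => by
    have e : kd (wa - wb) T = (z T - kd wb T) - (z T - kd wa T) := by
      rw [map_sub, Pi.sub_apply]; ring
    rw [e]
    exact sub_mem (Ideal.mem_sup_right (hb' T)) (Ideal.mem_sup_left (ha' T)))
  choose a haA b hbB hab using fun T => Submodule.mem_sup.1 (hu' T)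
  refine ⟨wa - a, fun T => ⟨?_, ?_⟩⟩
  · have e : z T - kd (wa - a) T = (z T - kd wa T) + kd a T := by
      rw [map_sub, Pi.sub_apply]; ring
    rw [e]; exact add_mem (ha' T) (kd_mem haA T)
  · have e0 : wa - a = wb + b + kd u := by
      funext T
      have := hab T
      simp only [Pi.sub_apply, Pi.add_apply] at this ⊢
      linear_combination -this
    have e : z T - kd (wa - a) T = (z T - kd wb T) - kd b T := by
      rw [e0, map_add, map_add, kd_kd, Pi.add_apply, Pi.add_apply, Pi.zero_apply]; ring
    rw [e]; exact sub_mem (hb' T) (kd_mem hbB T)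

theorem RegLE.of_regular {I : Ideal (MvPolynomial σ K)} {r : ℕ} (hI : HomI I) (v : σ)
    (hreg : ∀ f, X v * f ∈ I → f ∈ I) (h : RegLE (I ⊔ Ideal.span {X v}) r) : RegLE I r := by
  refine RegLE.of_weak hI fun d hd z hz hz' => ?_
  obtain ⟨w, hw, hw'⟩ := h d hd z hz (fun T => Ideal.mem_sup_left (hz' T))
  have : ∀ T, ∃ a ∈ I, ∃ b, a + X v * b = z T - kd w T := by
    intro T
    obtain ⟨a, ha, b, hb, hab⟩ := Submodule.mem_sup.1 (hw' T)
    obtain ⟨c, rfl⟩ := Ideal.mem_span_singleton'.1 hb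
    exact ⟨a, ha, c, by rw [← hab]; ring⟩
  choose a ha b hab using this
  have hk := kd_ke v b
  have hb : ∀ T, kd b T ∈ I := by
    intro T
    apply hreg
    have e : z - kd w - a = (X v : MvPolynomial σ K) • b := by
      funext T
      have := hab T
      simp only [Pi.sub_apply, Pi.smul_apply, smul_eq_mul]
      linear_combination -this
    have e2 : X v * kd b T = kd z T - kd a T := by
      have := congrFun (congrArg kd e) T
      rw [map_smul, map_sub, map_sub, kd_kd] at this
      simp only [Pi.sub_apply, Pi.smul_apply, smul_eq_mul, Pi.zero_apply] at this
      linear_combination -this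
    rw [e2]
    exact sub_mem (hz' T) (kd_mem ha T)
  refine ⟨w + ke v b, fun T => ?_⟩
  have e : z T - kd (w + ke v b) T = a T + ke v (kd b) T := by
    have h1 := congrFun hk T
    rw [Pi.add_apply] at h1
    rw [map_add, Pi.add_apply]
    linear_combination -hab T - h1
  rw [e]
  exact add_mem (ha T) (ke_mem hb v T)

theorem mem_of_constantCoeff {I : Ideal (MvPolynomial σ K)} (h : ∀ s, X s ∈ I)
    {f : MvPolynomial σ K} (hf : constantCoeff f = 0) : f ∈ I := by
  rw [f.as_sum]
  refine Ideal.sum_mem _ fun m hm => ?_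
  have hm0 : m ≠ 0 := by
    rintro rfl
    exact (mem_support_iff.1 hm) hf
  obtain ⟨s, hs⟩ := Finsupp.ne_iff.1 hm0
  have : monomial m (coeff m f) = X s * monomial (m - Finsupp.single s 1) (coeff m f) := by
    rw [X, monomial_mul, one_mul]
    have e : m = Finsupp.single s 1 + (m - Finsupp.single s 1) := by
      ext t
      by_cases ht : s = t
      · subst ht; simp at hs ⊢; omega
      · simp [ht]
    rw [← e]
  rw [this]
  exact Ideal.mul_mem_right _ _ (h s)

theorem constantCoeff_of_hom {f : MvPolynomial σ K} {d : ℕ} (hf : f.IsHomogeneous d)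
    (hd : d ≠ 0) : constantCoeff f = 0 := by
  by_contra h
  rw [constantCoeff_eq] at h
  have := hf h
  simp at this
  exact hd this.symm

theorem RegLE.of_max {I : Ideal (MvPolynomial σ K)} (h : ∀ s, X s ∈ I) : RegLE I 0 := by
  intro d _ z hz _
  refine ⟨0, fun T => isHomogeneous_zero _ _ _, fun T => ?_⟩
  rw [map_zero, Pi.zero_apply, sub_zero]
  exact mem_of_constantCoeff h (constantCoeff_of_hom (hz T) (Nat.succ_ne_zero d))

end Reg

section Res

variable {σ K : Type} [Fintype σ] [DecidableEq σ] [Field K]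

/-- `f` lies in degree `k` of `S(-a)`. -/
def PH (f : MvPolynomial σ K) (a k : ℕ) : Prop := ∀ m, coeff m f ≠ 0 → m.degree + a = k

theorem weight_one' (m : σ →₀ ℕ) : (Finsupp.weight (1 : σ → ℕ)) m = m.degree := by
  rw [Finsupp.degree_eq_weight_one]; rfl

theorem PH.mul {f g : MvPolynomial σ K} {a b k : ℕ} (hf : PH f a b) (hg : PH g b k) :
    PH (f * g) a k := by
  intro m hm
  rw [coeff_mul] at hm
  obtain ⟨p, hp, hne⟩ := Finset.exists_ne_zero_of_sum_ne_zero hm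
  have h1 := hf p.1 (left_ne_zero_of_mul hne)
  have h2 := hg p.2 (right_ne_zero_of_mul hne)
  have h3 := Finset.HasAntidiagonal.mem_antidiagonal.1 hp
  have h4 : m.degree = p.1.degree + p.2.degree := by rw [← h3, map_add]
  omega

theorem PH.sum {ι : Type} [Fintype ι] {f : ι → MvPolynomial σ K} {a k : ℕ}
    (h : ∀ i, PH (f i) a k) : PH (∑ i, f i) a k := by
  intro m hm
  rw [coeff_sum] at hm
  obtain ⟨p, _, hne⟩ := Finset.exists_ne_zero_of_sum_ne_zero hm
  exact h p m hne

theorem PH.of_hom {f : MvPolynomial σ K} {a k : ℕ} (h : f.IsHomogeneous (k - a)) (hak : a ≤ k) :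
    PH f a k := by
  intro m hm
  have := h hm
  rw [weight_one'] at this
  omega

theorem PH.hom {f : MvPolynomial σ K} {a k d : ℕ} (h : PH f a k) (hd : d + a = k) :
    f.IsHomogeneous d := by
  intro m hm
  have := h m hm
  rw [weight_one']
  omega

theorem PH.zero {a k : ℕ} : PH (0 : MvPolynomial σ K) a k := by
  intro m hm; simp at hm

theorem kd_sum {ι : Type} [Fintype ι] (g : ι → MvPolynomial σ K)
    (z : Finset σ → ι → MvPolynomial σ K) (T : Finset σ) :
    kd (fun T => ∑ e, g e * z T e) T = ∑ e, g e * kd (fun T => z T e) T := by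
  have h : (fun T => ∑ e, g e * z T e) = ∑ e, g e • (fun T => z T e) := by
    funext T; simp
  rw [h, map_sum, Finset.sum_apply]
  simp

theorem acyclic (h0 : RegLE (⊥ : Ideal (MvPolynomial σ K)) 0) {a k : ℕ}
    (z : Finset σ → MvPolynomial σ K) (hz : ∀ T, PH (z T) a (k + 1))
    (hc : ∀ T, constantCoeff (z T) = 0) (hk : ∀ T, kd z T = 0) :
    ∃ w, (∀ T, PH (w T) a k) ∧ kd w = z := by
  by_cases hak : a ≤ k
  · obtain ⟨w, hw, hw'⟩ := h0 (k - a) (Nat.zero_le _) z (fun T => (hz T).hom (by omega))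
      (fun T => by rw [hk T]; exact zero_mem _)
    refine ⟨w, fun T => PH.of_hom (hw T) hak, ?_⟩
    funext T
    have := hw' T
    rw [Ideal.mem_bot, sub_eq_zero] at this
    exact this.symm
  · have : z = 0 := by
      funext T
      ext m
      by_contra hm
      have hm' : coeff m (z T) ≠ 0 := by simpa using hm
      have h1 := hz T m hm'
      have h2 : m = 0 := by
        rw [← Finsupp.degree_eq_zero_iff]; omega
      subst h2
      exact hm' (hc T)
    exact ⟨0, fun T => PH.zero, by rw [this, map_zero]⟩

theorem res_strand {I : Ideal (MvPolynomial σ K)} (F : MinimalGradedFreeResolutionOfQuotient I)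
    {r : ℕ} (h0 : RegLE (⊥ : Ideal (MvPolynomial σ K)) 0) (hI : RegLE I r) (i : ℕ) :
    ∀ d, r < d → ∀ z : Finset σ → Fin (F.rank i) → MvPolynomial σ K,
      (∀ T e, PH (z T e) (F.twist i e) (i + d)) →
      (∀ T, ∃ u, (fun e => kd (fun T => z T e) T) = (F.diff i).mulVec u) →
      ∃ w : Finset σ → Fin (F.rank i) → MvPolynomial σ K,
        ∀ T, ∃ u, (fun e => z T e - kd (fun T => w T e) T) = (F.diff i).mulVec u := by
  induction i with
  | zero =>
    intro d hd z hz hz'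
    obtain ⟨d, rfl⟩ : ∃ d', d = d' + 1 := ⟨d - 1, by omega⟩
    obtain ⟨w0, hw0, hw0'⟩ := hI d (by omega) (fun T => ∑ e, F.gen e * z T e)
      (fun T => (PH.sum fun e => (PH.of_hom (a := 0) (F.gen_homog e) (Nat.zero_le _)).mul
        (hz T e)).hom (by omega))
      (fun T => by
        rw [kd_sum]
        have := (F.exact_zero _).2 (hz' T)
        simpa only [mul_comm] using this)
    choose c hc using fun T => F.gen_span (w0 T)
    refine ⟨c, fun T => ?_⟩
    refine (F.exact_zero _).1 ?_
    have e : ∑ e, (z T e - kd (fun T => c T e) T) * F.gen e =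
        (∑ e, F.gen e * z T e - kd w0 T) + kd (fun T => w0 T - ∑ e, c T e * F.gen e) T := by
      have h1 : (fun T => w0 T - ∑ e, c T e * F.gen e) =
          w0 - fun T => ∑ e, F.gen e * c T e := by
        funext T; simp only [Pi.sub_apply, mul_comm]
      rw [h1, map_sub, Pi.sub_apply, kd_sum]
      simp only [sub_mul, Finset.sum_sub_distrib, mul_comm (F.gen _)]
      ring
    rw [e]
    exact add_mem (hw0' T) (kd_mem hc T)
  | succ i ih =>
    intro d hd z hz hz'
    have hkd : ∀ (y : Finset σ → Fin (F.rank (i + 1)) → MvPolynomial σ K) (T) (e),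
        kd (fun T => (F.diff i).mulVec (y T) e) T =
          (F.diff i).mulVec (fun c => kd (fun T => y T c) T) e := by
      intro y T e
      exact kd_sum (F.diff i e) y T
    have hPH : ∀ T e, PH ((F.diff i).mulVec (z T) e) (F.twist i e) (i + d + 1) := by
      intro T e
      refine PH.sum fun c => ?_
      rcases F.diff_homog i e c with h | ⟨h1, h2⟩
      · simp only [h, zero_mul]; exact PH.zero
      · have := (PH.of_hom h2 h1).mul (hz T c)
        rwa [show i + 1 + d = i + d + 1 by ring] at this
    have hcz : ∀ T e, constantCoeff ((F.diff i).mulVec (z T) e) = 0 := by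
      intro T e
      simp only [Matrix.mulVec, dotProduct, map_sum, map_mul, F.minimal, zero_mul,
        Finset.sum_const_zero]
    have hkz : ∀ e T, kd (fun T => (F.diff i).mulVec (z T) e) T = 0 := by
      intro e T
      rw [hkd, (F.exact_succ i _).2 (hz' T)]; rfl
    choose w' hw' hw'' using fun e => acyclic h0 (fun T => (F.diff i).mulVec (z T) e)
      (fun T => hPH T e) (fun T => hcz T e) (hkz e)
    obtain ⟨w2, hw2⟩ := ih d hd (fun T e => w' e T) (fun T e => hw' e T)
      (fun T => ⟨z T, by
        funext e
        exact congrFun (hw'' e) T⟩)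
    choose u hu using hw2
    refine ⟨u, fun T => (F.exact_succ i _).1 ?_⟩
    funext e
    have h1 : (F.diff i).mulVec (fun c => kd (fun T => u T c) T) e =
        (F.diff i).mulVec (z T) e := by
      rw [← hkd]
      have h2 : (fun T => (F.diff i).mulVec (u T) e) = w' e - kd (fun T => w2 T e) := by
        funext T
        exact (congrFun (hu T) e).symm
      rw [h2, map_sub, kd_kd, sub_zero, hw'']
    have h3 : (fun e => z T e - kd (fun T => u T e) T) = z T - fun c => kd (fun T => u T c) T := rfl
    rw [h3, Matrix.mulVec_sub, Pi.sub_apply, h1, sub_self]; rfl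

theorem constantCoeff_kd (w : Finset σ → MvPolynomial σ K) (T : Finset σ) :
    constantCoeff (kd w T) = 0 := by
  rw [kd_apply, map_sum]
  refine Finset.sum_eq_zero fun s _ => ?_
  split_ifs <;> simp

theorem res_bound {I : Ideal (MvPolynomial σ K)} (F : MinimalGradedFreeResolutionOfQuotient I)
    {r : ℕ} (h0 : RegLE (⊥ : Ideal (MvPolynomial σ K)) 0) (hI : RegLE I r) : F.reg ≤ r := by
  refine csSup_le' ?_
  rintro d ⟨i, e, hie⟩
  by_contra hd
  obtain ⟨w, hw⟩ := res_strand F h0 hI i d (not_le.1 hd)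
    (fun T e' => if T = ∅ ∧ e' = e then 1 else 0) (fun T e' => by
      split_ifs with h
      · intro m hm
        rw [coeff_one] at hm
        have : m = 0 := by
          by_contra h'
          exact hm (if_neg (Ne.symm h'))
        subst this
        rw [h.2, hie]; simp [add_comm]
      · exact PH.zero) (fun T => ⟨0, by
      funext e'
      rw [Matrix.mulVec_zero, kd_apply, Pi.zero_apply]
      refine Finset.sum_eq_zero fun s _ => ?_
      simp⟩)
  obtain ⟨u, hu⟩ := hw ∅
  have h1 := congrArg constantCoeff (congrFun hu e)
  simp only [and_self, if_true, map_sub, constantCoeff_kd, map_one, Matrix.mulVec, dotProduct,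
    map_sum, map_mul, F.minimal, zero_mul, Finset.sum_const_zero] at h1
  simp at h1

end Res

section Eta

variable {V : Type} [Fintype V]

/-- delete vertices (keeping them isolated) -/
def del (G : SimpleGraph V) (D : Set V) : SimpleGraph V where
  Adj a b := G.Adj a b ∧ a ∉ D ∧ b ∉ D
  symm := ⟨fun _ _ h => ⟨h.1.symm, h.2.2, h.2.1⟩⟩
  loopless := ⟨fun _ h => h.1.ne rfl⟩

/-- complete the neighbourhood of `v` -/
def cpl (G : SimpleGraph V) (v : V) : SimpleGraph V where
  Adj a b := G.Adj a b ∨ (a ≠ b ∧ G.Adj v a ∧ G.Adj v b)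
  symm := ⟨fun _ _ h => h.elim (fun h => Or.inl h.symm) fun h => Or.inr ⟨h.1.symm, h.2.2, h.2.1⟩⟩
  loopless := ⟨fun _ h => h.elim (fun h => h.ne rfl) fun h => h.1 rfl⟩

/-- closed neighbourhood -/
def cn (G : SimpleGraph V) (v : V) : Set V := {w | w = v ∨ G.Adj v w}

theorem bdd_eta (G : SimpleGraph V) : BddAbove
    {k : ℕ | ∃ H : Finset (Sym2 V), IsCliqueDisjointEdgeSet G H ∧ H.card = k} := by
  classical
  refine ⟨Fintype.card (Sym2 V), ?_⟩
  rintro k ⟨H, _, rfl⟩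
  exact Finset.card_le_univ H

theorem le_eta {G : SimpleGraph V} {H : Finset (Sym2 V)} (h : IsCliqueDisjointEdgeSet G H) :
    H.card ≤ eta G := le_csSup (bdd_eta G) ⟨H, h, rfl⟩

theorem exists_eta (G : SimpleGraph V) :
    ∃ H : Finset (Sym2 V), IsCliqueDisjointEdgeSet G H ∧ H.card = eta G := by
  have : eta G ∈ {k : ℕ | ∃ H : Finset (Sym2 V), IsCliqueDisjointEdgeSet G H ∧ H.card = k} :=
    Nat.sSup_mem ⟨0, ∅, ⟨by simp, by simp⟩, rfl⟩ (bdd_eta G)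
  exact this

theorem cd_del {G : SimpleGraph V} {D : Set V} {H : Finset (Sym2 V)}
    (h : IsCliqueDisjointEdgeSet (del G D) H) : IsCliqueDisjointEdgeSet G H := by
  have hD : ∀ e ∈ H, ∀ v ∈ e, v ∉ D := by
    intro e he v hv
    have h1 := h.1 he
    induction e using Sym2.ind with
    | _ a b =>
      rw [SimpleGraph.mem_edgeSet] at h1
      rcases Sym2.mem_iff.1 hv with rfl | rfl
      · exact h1.2.1
      · exact h1.2.2
  refine ⟨fun e he => ?_, fun e₁ h₁ e₂ h₂ hne => ?_⟩
  · have h1 := h.1 he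
    induction e using Sym2.ind with
    | _ a b =>
      rw [SimpleGraph.mem_edgeSet] at h1 ⊢
      exact h1.1
  · rintro ⟨C, hC, hC1, hC2⟩
    refine h.2 e₁ h₁ e₂ h₂ hne ⟨C \ D, ?_, fun v hv => ⟨hC1 v hv, hD _ h₁ v hv⟩,
      fun v hv => ⟨hC2 v hv, hD _ h₂ v hv⟩⟩
    intro a ha b hb hab
    exact ⟨hC ha.1 hb.1 hab, ha.2, hb.2⟩

theorem eta_del_le (G : SimpleGraph V) (D : Set V) : eta (del G D) ≤ eta G := by
  obtain ⟨H, hH, hc⟩ := exists_eta (del G D)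
  rw [← hc]
  exact le_eta (cd_del hH)

theorem cn_clique (G : SimpleGraph V) (v : V) : (cpl G v).IsClique (cn G v) := by
  rintro a ha b hb hab
  rcases ha with rfl | ha
  · rcases hb with rfl | hb
    · exact absurd rfl hab
    · exact Or.inl hb
  · rcases hb with rfl | hb
    · exact Or.inl ha.symm
    · exact Or.inr ⟨hab, ha, hb⟩

theorem cd_filter {G : SimpleGraph V} {v : V} {H : Finset (Sym2 V)}
    (h : IsCliqueDisjointEdgeSet (cpl G v) H) :
    ∃ H0, IsCliqueDisjointEdgeSet G H0 ∧ (∀ e ∈ H0, ¬ ∀ w ∈ e, w ∈ cn G v) ∧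
      H.card ≤ H0.card + 1 := by
  classical
  refine ⟨H.filter (fun e => ¬ ∀ w ∈ e, w ∈ cn G v), ⟨fun e he => ?_, ?_⟩,
    fun e he => (Finset.mem_filter.1 he).2, ?_⟩
  · have he := Finset.mem_filter.1 (Finset.mem_coe.1 he)
    have h1 := h.1 he.1
    have h2 := he.2
    clear he
    induction e using Sym2.ind with
    | _ a b =>
      rw [SimpleGraph.mem_edgeSet] at h1 ⊢
      rcases h1 with h1 | h1
      · exact h1
      · refine absurd ?_ h2
        intro w hw
        rcases Sym2.mem_iff.1 hw with rfl | rfl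
        · exact Or.inr h1.2.1
        · exact Or.inr h1.2.2
  · intro e₁ h₁ e₂ h₂ hne
    rintro ⟨C, hC, hC1, hC2⟩
    refine h.2 e₁ (Finset.mem_filter.1 h₁).1 e₂ (Finset.mem_filter.1 h₂).1 hne ⟨C, ?_, hC1, hC2⟩
    intro a ha b hb hab
    exact Or.inl (hC ha hb hab)
  · rw [← Finset.card_filter_add_card_filter_not (s := H) (fun e => ∀ w ∈ e, w ∈ cn G v), add_comm]
    refine Nat.add_le_add_left ?_ _
    rw [Finset.card_le_one]
    intro e₁ h₁ e₂ h₂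
    by_contra hne
    rw [Finset.mem_filter] at h₁ h₂
    exact h.2 e₁ h₁.1 e₂ h₂.1 hne ⟨cn G v, cn_clique G v, h₁.2, h₂.2⟩

theorem cd_insert [DecidableEq V] {G : SimpleGraph V} {H : Finset (Sym2 V)}
    (h : IsCliqueDisjointEdgeSet G H)
    {e : Sym2 V} (he : e ∈ G.edgeSet) (hH : ∀ f ∈ H, ¬ ∃ C : Set V, G.IsClique C ∧
      (∀ v ∈ e, v ∈ C) ∧ ∀ v ∈ f, v ∈ C) :
    IsCliqueDisjointEdgeSet G (insert e H) ∧ (insert e H).card = H.card + 1 := by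
  refine ⟨⟨?_, ?_⟩, ?_⟩
  · intro f hf
    rcases Finset.mem_insert.1 (Finset.mem_coe.1 hf) with rfl | hf
    · exact he
    · exact h.1 hf
  · intro e₁ h₁ e₂ h₂ hne
    rcases Finset.mem_insert.1 h₁ with rfl | k₁
    · rcases Finset.mem_insert.1 h₂ with rfl | k₂
      · exact absurd rfl hne
      · exact hH _ k₂
    · rcases Finset.mem_insert.1 h₂ with rfl | k₂
      · rintro ⟨C, hC, h1, h2⟩
        exact hH _ k₁ ⟨C, hC, h2, h1⟩
      · exact h.2 _ k₁ _ k₂ hne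
  · apply Finset.card_insert_of_notMem
    intro hmem
    refine hH e hmem ⟨{v | v ∈ e}, ?_, fun v hv => hv, fun v hv => hv⟩
    clear hH hmem
    induction e using Sym2.ind with
    | _ a b =>
      rw [SimpleGraph.mem_edgeSet] at he
      intro x hx y hy hxy
      rcases Sym2.mem_iff.1 hx with rfl | rfl <;> rcases Sym2.mem_iff.1 hy with rfl | rfl
      · exact absurd rfl hxy
      · exact he
      · exact he.symm
      · exact absurd rfl hxy

theorem clique_cn {G : SimpleGraph V} {v : V} {C : Set V} (hC : G.IsClique C) (hv : v ∈ C) {w : V}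
    (hw : w ∈ C) : w ∈ cn G v := by
  by_cases h : w = v
  · exact Or.inl h
  · exact Or.inr (hC hv hw (Ne.symm h))

theorem core1 {G : SimpleGraph V} {v a : V} (ha : G.Adj v a) {H : Finset (Sym2 V)}
    (h : IsCliqueDisjointEdgeSet G H) (hH : ∀ e ∈ H, ¬ ∀ w ∈ e, w ∈ cn G v) :
    H.card + 1 ≤ eta G := by
  classical
  have h1 := cd_insert (e := s(v, a)) h ha (fun f hf => by
    rintro ⟨C, hC, h1, h2⟩
    exact hH f hf fun w hw => clique_cn hC (h1 v (by simp)) (h2 w hw))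
  rw [← h1.2]
  exact le_eta h1.1

theorem core2 {G : SimpleGraph V} {v a b : V} (ha : G.Adj v a) (hb : G.Adj v b) (hab : a ≠ b)
    (hn : ¬ G.Adj a b) {H : Finset (Sym2 V)}
    (h : IsCliqueDisjointEdgeSet G H) (hH : ∀ e ∈ H, ¬ ∀ w ∈ e, w ∈ cn G v) :
    H.card + 2 ≤ eta G := by
  classical
  have h1 := cd_insert (e := s(v, a)) h ha (fun f hf => by
    rintro ⟨C, hC, h1, h2⟩
    exact hH f hf fun w hw => clique_cn hC (h1 v (by simp)) (h2 w hw))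
  have h2 := cd_insert (e := s(v, b)) h1.1 hb (fun f hf => by
    rintro ⟨C, hC, h1, h2⟩
    rcases Finset.mem_insert.1 hf with rfl | hf
    · exact hn (hC (h2 a (by simp)) (h1 b (by simp)) hab)
    · exact hH f hf fun w hw => clique_cn hC (h1 v (by simp)) (h2 w hw))
  have := le_eta h2.1
  rw [h2.2, h1.2] at this
  exact this

theorem eta_cpl_le {G : SimpleGraph V} {v a : V} (ha : G.Adj v a) : eta (cpl G v) ≤ eta G := by
  obtain ⟨H, hH, hc⟩ := exists_eta (cpl G v)
  obtain ⟨H0, h1, h2, h3⟩ := cd_filter hH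
  have := core1 ha h1 h2
  omega

theorem eta_cpl_del_lt {G : SimpleGraph V} {v a b : V} (ha : G.Adj v a) (hb : G.Adj v b)
    (hab : a ≠ b) (hn : ¬ G.Adj a b) (D : Set V) : eta (del (cpl G v) D) + 1 ≤ eta G := by
  obtain ⟨H, hH, hc⟩ := exists_eta (del (cpl G v) D)
  obtain ⟨H0, h1, h2, h3⟩ := cd_filter (cd_del hH)
  have := core2 ha hb hab hn h1 h2
  omega

theorem eta_del_cn_lt {G : SimpleGraph V} {v a : V} (ha : G.Adj v a) :
    eta (del G (cn G v)) + 1 ≤ eta G := by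
  obtain ⟨H, hH, hc⟩ := exists_eta (del G (cn G v))
  rw [← hc]
  refine core1 ha (cd_del hH) fun e he => ?_
  have h1 := hH.1 he
  induction e using Sym2.ind with
  | _ a b =>
    rw [SimpleGraph.mem_edgeSet] at h1
    intro h
    exact h1.2.1 (h a (by simp))

theorem eta_le_count (G : SimpleGraph V) : eta G ≤ maximalCliqueCount G := by
  classical
  obtain ⟨H, hH, hc⟩ := exists_eta G
  rw [← hc]
  have key : ∀ e ∈ H, ∃ C : Finset V, Maximal (fun D : Finset V => G.IsClique ↑D) C ∧
      ∀ v ∈ e, v ∈ C := by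
    intro e he
    have h1 := hH.1 he
    have h2 : G.IsClique (↑(Finset.univ.filter (fun v => v ∈ e)) : Set V) := by
      clear he
      induction e using Sym2.ind with
      | _ a b =>
        rw [SimpleGraph.mem_edgeSet] at h1
        intro x hx y hy hxy
        have hx : x ∈ s(a, b) := by simpa using hx
        have hy : y ∈ s(a, b) := by simpa using hy
        rcases Sym2.mem_iff.1 hx with rfl | rfl <;> rcases Sym2.mem_iff.1 hy with rfl | rfl
        · exact absurd rfl hxy
        · exact h1
        · exact h1.symm
        · exact absurd rfl hxy
    obtain ⟨C, hle, hC⟩ := (Set.toFinite {D : Finset V | G.IsClique (↑D : Set V)}).exists_le_maximal h2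
    exact ⟨C, hC, fun v hv => hle (by simpa using hv)⟩
  choose! f hf hf' using key
  unfold maximalCliqueCount
  rw [← Set.ncard_coe_finset]
  refine Set.ncard_le_ncard_of_injOn f (fun e he => hf e he) ?_ (Set.toFinite _)
  intro e₁ h₁ e₂ h₂ heq
  by_contra hne
  refine hH.2 e₁ h₁ e₂ h₂ hne ⟨↑(f e₁), (hf e₁ h₁).prop, fun v hv => hf' e₁ h₁ v hv, fun v hv => ?_⟩
  rw [heq]
  exact hf' e₂ h₂ v hv

end Eta

section Toric

variable {V K : Type} [Fintype V] [DecidableEq V] [Field K]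

/-- binomial edge ideal plus variables -/
def bI (K : Type) [Field K] (U : Set (V ⊕ V)) (G : SimpleGraph V) :
    Ideal (MvPolynomial (V ⊕ V) K) :=
  binomialEdgeIdeal K G ⊔ Ideal.span (X '' U)

theorem X_mem_bI {U : Set (V ⊕ V)} (G : SimpleGraph V) {s : V ⊕ V} (h : s ∈ U) :
    X s ∈ bI K U G :=
  Ideal.mem_sup_right (Ideal.subset_span ⟨s, h, rfl⟩)

theorem edge_mem_bI (U : Set (V ⊕ V)) {G : SimpleGraph V} {a b : V} (h : G.Adj a b) :
    X (Sum.inl a) * X (Sum.inr b) - X (Sum.inl b) * X (Sum.inr a) ∈ bI K U G :=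
  Ideal.mem_sup_left (Ideal.subset_span ⟨a, b, h, rfl⟩)

theorem bI_le {U : Set (V ⊕ V)} {G : SimpleGraph V} {J : Ideal (MvPolynomial (V ⊕ V) K)}
    (h1 : ∀ s ∈ U, X s ∈ J)
    (h2 : ∀ a b, G.Adj a b →
      X (Sum.inl a) * X (Sum.inr b) - X (Sum.inl b) * X (Sum.inr a) ∈ J) : bI K U G ≤ J := by
  refine sup_le ?_ ?_
  · refine Ideal.span_le.2 ?_
    rintro f ⟨a, b, hab, rfl⟩
    exact h2 a b hab
  · refine Ideal.span_le.2 ?_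
    rintro f ⟨s, hs, rfl⟩
    exact h1 s hs

/-- exponent of the image of a variable under the toric map -/
def te (G : SimpleGraph V) : V ⊕ V → (V ⊕ (Set V ⊕ Set V)) →₀ ℕ
  | Sum.inl w => Finsupp.single (Sum.inl w) 1 + Finsupp.single (Sum.inr (Sum.inl (cn G w))) 1
  | Sum.inr w => Finsupp.single (Sum.inl w) 1 + Finsupp.single (Sum.inr (Sum.inr (cn G w))) 1

/-- exponent of the image of a monomial -/
def tE (G : SimpleGraph V) (m : (V ⊕ V) →₀ ℕ) : (V ⊕ (Set V ⊕ Set V)) →₀ ℕ :=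
  ∑ s, m s • te G s

theorem tE_add (G : SimpleGraph V) (m m' : (V ⊕ V) →₀ ℕ) : tE G (m + m') = tE G m + tE G m' := by
  simp [tE, add_smul, Finset.sum_add_distrib]

theorem tE_single (G : SimpleGraph V) (s : V ⊕ V) : tE G (Finsupp.single s 1) = te G s := by
  rw [tE, Finset.sum_eq_single s]
  · simp
  · intro t _ h
    rw [Finsupp.single_apply, if_neg (Ne.symm h), zero_smul]
  · simp

theorem tE_ne {G : SimpleGraph V} {m : (V ⊕ V) →₀ ℕ} {t} :
    tE G m t ≠ 0 ↔ ∃ s, m s ≠ 0 ∧ te G s t ≠ 0 := by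
  rw [tE, Finsupp.finsetSum_apply, ne_eq, Finset.sum_eq_zero_iff]
  push Not
  simp only [Finset.mem_univ, true_and, Finsupp.smul_apply, smul_eq_mul, mul_ne_zero_iff]

theorem te_inl_inl (G : SimpleGraph V) (s : V ⊕ V) (w : V) :
    te G s (Sum.inl w) ≠ 0 ↔ s = Sum.inl w ∨ s = Sum.inr w := by
  classical
  rcases s with s | s <;> simp [te, Finsupp.single_apply]

theorem te_inr_inl (G : SimpleGraph V) (s : V ⊕ V) (c : Set V) :
    te G s (Sum.inr (Sum.inl c)) ≠ 0 ↔ ∃ u, s = Sum.inl u ∧ cn G u = c := by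
  classical
  rcases s with s | s <;> simp [te, Finsupp.single_apply]

theorem te_inr_inr (G : SimpleGraph V) (s : V ⊕ V) (c : Set V) :
    te G s (Sum.inr (Sum.inr c)) ≠ 0 ↔ ∃ u, s = Sum.inr u ∧ cn G u = c := by
  classical
  rcases s with s | s <;> simp [te, Finsupp.single_apply]

theorem cn_eq {G : SimpleGraph V} (htr : ∀ v a b, G.Adj v a → G.Adj v b → a ≠ b → G.Adj a b)
    {u w : V} (h : G.Adj u w) : cn G u = cn G w := by
  ext x
  constructor
  · rintro (rfl | hx)
    · exact Or.inr h.symm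
    · by_cases hxw : x = w
      · exact Or.inl hxw
      · exact Or.inr (htr u w x h hx (Ne.symm hxw))
  · rintro (rfl | hx)
    · exact Or.inr h
    · by_cases hxw : x = u
      · exact Or.inl hxw
      · exact Or.inr (htr w u x h.symm hx (Ne.symm hxw))

theorem split_single {m : (V ⊕ V) →₀ ℕ} {s : V ⊕ V} (h : m s ≠ 0) :
    ∃ m', m = Finsupp.single s 1 + m' := by
  refine ⟨m - Finsupp.single s 1, ?_⟩
  ext t
  by_cases ht : s = t
  · subst ht; simp; omega
  · simp [ht]

theorem swap_step {U : Set (V ⊕ V)} {G : SimpleGraph V}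
    (hU : ∀ a b, G.Adj a b → Sum.inl a ∉ U ∧ Sum.inr a ∉ U)
    (htr : ∀ v a b, G.Adj v a → G.Adj v b → a ≠ b → G.Adj a b)
    {m : (V ⊕ V) →₀ ℕ} (hm : ∀ s ∈ U, m s = 0) {p q : V} (hpq : G.Adj p q)
    (hp : m (Sum.inl p) ≠ 0) (hq : m (Sum.inr q) ≠ 0) :
    ∃ m3 : (V ⊕ V) →₀ ℕ, (∀ s ∈ U, m3 s = 0) ∧ tE G m3 = tE G m ∧ m3 (Sum.inl q) ≠ 0 ∧
      m3 (Sum.inr p) ≠ 0 ∧ (monomial m (1 : K) - monomial m3 1) ∈ bI K U G := by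
  obtain ⟨m1, rfl⟩ := split_single hp
  have hq1 : m1 (Sum.inr q) ≠ 0 := by simpa using hq
  obtain ⟨m2, rfl⟩ := split_single hq1
  refine ⟨Finsupp.single (Sum.inl q) 1 + (Finsupp.single (Sum.inr p) 1 + m2), ?_, ?_, ?_, ?_, ?_⟩
  · intro s hs
    have h1 := hm s hs
    have hqs : Sum.inl q ≠ s := fun h => (hU q p hpq.symm).1 (h ▸ hs)
    have hps : Sum.inr p ≠ s := fun h => (hU p q hpq).2 (h ▸ hs)
    simp only [Finsupp.add_apply, Finsupp.single_apply, hqs, hps, if_false] at h1 ⊢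
    omega
  · simp only [tE_add, tE_single, te]
    rw [cn_eq htr hpq]
    abel
  · simp
  · simp
  · have e : (monomial (Finsupp.single (Sum.inl p) 1 + (Finsupp.single (Sum.inr q) 1 + m2)) (1 : K)
        - monomial (Finsupp.single (Sum.inl q) 1 + (Finsupp.single (Sum.inr p) 1 + m2)) 1) =
        (X (Sum.inl p) * X (Sum.inr q) - X (Sum.inl q) * X (Sum.inr p)) * monomial m2 1 := by
      simp only [X, sub_mul, monomial_mul, one_mul, add_assoc]
    rw [e]
    exact Ideal.mul_mem_right _ _ (edge_mem_bI U hpq)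

theorem cancel_step {U : Set (V ⊕ V)} {G : SimpleGraph V} {n : ℕ}
    (ih : ∀ m : (V ⊕ V) →₀ ℕ, m.degree = n → (∀ s ∈ U, m s = 0) → ∀ m' : (V ⊕ V) →₀ ℕ,
      (∀ s ∈ U, m' s = 0) → tE G m = tE G m' →
      (monomial m (1 : K) - monomial m' 1) ∈ bI K U G)
    {m m' : (V ⊕ V) →₀ ℕ} (hd : m.degree = n + 1) (hm : ∀ s ∈ U, m s = 0)
    (hm' : ∀ s ∈ U, m' s = 0) (hE : tE G m = tE G m') {s : V ⊕ V} (hs : m s ≠ 0)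
    (hs' : m' s ≠ 0) : (monomial m (1 : K) - monomial m' 1) ∈ bI K U G := by
  obtain ⟨m1, rfl⟩ := split_single hs
  obtain ⟨m2, rfl⟩ := split_single hs'
  have e : (monomial (Finsupp.single s 1 + m1) (1 : K) - monomial (Finsupp.single s 1 + m2) 1) =
      X s * (monomial m1 1 - monomial m2 1) := by
    simp only [X, mul_sub, monomial_mul, one_mul]
  rw [e]
  refine Ideal.mul_mem_left _ _ (ih m1 ?_ ?_ m2 ?_ ?_)
  · simp at hd; omega
  · intro t ht
    have := hm t ht
    rw [Finsupp.add_apply] at this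
    omega
  · intro t ht
    have := hm' t ht
    rw [Finsupp.add_apply] at this
    omega
  · rw [tE_add, tE_add] at hE
    exact add_left_cancel hE

theorem mono_cong {U : Set (V ⊕ V)} {G : SimpleGraph V}
    (hU : ∀ a b, G.Adj a b → Sum.inl a ∉ U ∧ Sum.inr a ∉ U)
    (htr : ∀ v a b, G.Adj v a → G.Adj v b → a ≠ b → G.Adj a b) (n : ℕ) :
    ∀ m : (V ⊕ V) →₀ ℕ, m.degree = n → (∀ s ∈ U, m s = 0) → ∀ m' : (V ⊕ V) →₀ ℕ,
      (∀ s ∈ U, m' s = 0) → tE G m = tE G m' →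
      (monomial m (1 : K) - monomial m' 1) ∈ bI K U G := by
  induction n with
  | zero =>
    intro m hd hm m' hm' hE
    have h0 : m = 0 := (Finsupp.degree_eq_zero_iff m).1 hd
    subst h0
    have h1 : m' = 0 := by
      ext s
      by_contra hs
      have h2 : ∃ w, te G s (Sum.inl w) ≠ 0 := by
        rcases s with w | w
        · exact ⟨w, (te_inl_inl _ _ _).2 (Or.inl rfl)⟩
        · exact ⟨w, (te_inl_inl _ _ _).2 (Or.inr rfl)⟩
      obtain ⟨w, hw⟩ := h2
      have h3 : tE G m' (Sum.inl w) ≠ 0 := tE_ne.2 ⟨s, hs, hw⟩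
      rw [← hE] at h3
      exact h3 (by simp [tE])
    rw [h1, sub_self]
    exact zero_mem _
  | succ n ih =>
    intro m hd hm m' hm' hE
    have hm0 : m ≠ 0 := by
      rintro rfl; simp at hd
    obtain ⟨s, hs⟩ := Finsupp.ne_iff.1 hm0
    have hs : m s ≠ 0 := by simpa using hs
    by_cases hs' : m' s = 0
    · have main : ∃ m3 : (V ⊕ V) →₀ ℕ, (∀ s ∈ U, m3 s = 0) ∧ tE G m3 = tE G m' ∧ m3 s ≠ 0 ∧
          (monomial m' (1 : K) - monomial m3 1) ∈ bI K U G := by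
        rcases s with w | w
        · have h1 : tE G m' (Sum.inl w) ≠ 0 := by
            rw [← hE]; exact tE_ne.2 ⟨_, hs, (te_inl_inl _ _ _).2 (Or.inl rfl)⟩
          have h2 : tE G m' (Sum.inr (Sum.inl (cn G w))) ≠ 0 := by
            rw [← hE]; exact tE_ne.2 ⟨_, hs, (te_inr_inl _ _ _).2 ⟨w, rfl, rfl⟩⟩
          obtain ⟨t, ht, ht'⟩ := tE_ne.1 h1
          obtain ⟨t2, ht2, ht2'⟩ := tE_ne.1 h2
          obtain ⟨u, rfl, hu⟩ := (te_inr_inl _ _ _).1 ht2'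
          rcases (te_inl_inl _ _ _).1 ht' with rfl | rfl
          · exact absurd hs' ht
          have huw : u ≠ w := by rintro rfl; exact ht2 hs'
          have hadj : G.Adj u w := by
            have : u ∈ cn G w := by rw [← hu]; exact Or.inl rfl
            exact (this.resolve_left huw).symm
          obtain ⟨m3, a1, a2, a3, a4, a5⟩ := swap_step (K := K) hU htr hm' hadj ht2 ht
          exact ⟨m3, a1, a2, a3, a5⟩
        · have h1 : tE G m' (Sum.inl w) ≠ 0 := by
            rw [← hE]; exact tE_ne.2 ⟨_, hs, (te_inl_inl _ _ _).2 (Or.inr rfl)⟩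
          have h2 : tE G m' (Sum.inr (Sum.inr (cn G w))) ≠ 0 := by
            rw [← hE]; exact tE_ne.2 ⟨_, hs, (te_inr_inr _ _ _).2 ⟨w, rfl, rfl⟩⟩
          obtain ⟨t, ht, ht'⟩ := tE_ne.1 h1
          obtain ⟨t2, ht2, ht2'⟩ := tE_ne.1 h2
          obtain ⟨u, rfl, hu⟩ := (te_inr_inr _ _ _).1 ht2'
          rcases (te_inl_inl _ _ _).1 ht' with rfl | rfl
          swap
          · exact absurd hs' ht
          have huw : u ≠ w := by rintro rfl; exact ht2 hs'
          have hadj : G.Adj w u := by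
            have : u ∈ cn G w := by rw [← hu]; exact Or.inl rfl
            exact (this.resolve_left huw)
          obtain ⟨m3, a1, a2, a3, a4, a5⟩ := swap_step (K := K) hU htr hm' hadj ht ht2
          exact ⟨m3, a1, a2, a4, a5⟩
      obtain ⟨m3, a1, a2, a3, a4⟩ := main
      have h5 := cancel_step ih hd hm a1 (hE.trans a2.symm) hs a3
      have h6 := sub_mem h5 a4
      rwa [sub_sub_sub_cancel_right] at h6
    · exact cancel_step ih hd hm hm' hE hs hs'

open Classical in
/-- the toric map -/
def tp (K : Type) [Field K] (U : Set (V ⊕ V)) (G : SimpleGraph V) :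
    MvPolynomial (V ⊕ V) K →ₐ[K] MvPolynomial (V ⊕ (Set V ⊕ Set V)) K :=
  aeval (fun s => if s ∈ U then 0 else monomial (te G s) 1)

theorem tp_monomial (U : Set (V ⊕ V)) (G : SimpleGraph V) {m : (V ⊕ V) →₀ ℕ}
    (hm : ∀ s ∈ U, m s = 0) : tp K U G (monomial m 1) = monomial (tE G m) 1 := by
  rw [tp, aeval_monomial, map_one, one_mul, tE, monomial_sum_one,
    Finsupp.prod_fintype _ _ (fun _ => pow_zero _)]
  refine Finset.prod_congr rfl fun s _ => ?_
  by_cases hs : s ∈ U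
  · rw [hm s hs, pow_zero, zero_smul, monomial_zero', map_one]
  · rw [if_neg hs, monomial_pow, one_pow]

theorem tp_monomial_zero (U : Set (V ⊕ V)) (G : SimpleGraph V) {m : (V ⊕ V) →₀ ℕ}
    {s : V ⊕ V} (hs : s ∈ U) (hm : m s ≠ 0) : tp K U G (monomial m 1) = 0 := by
  obtain ⟨m', rfl⟩ := split_single hm
  have e : monomial (Finsupp.single s 1 + m') (1 : K) = X s * monomial m' 1 := by
    rw [X, monomial_mul, one_mul]
  rw [e, map_mul, tp, aeval_X, if_pos hs, zero_mul]

theorem mem_of_tp {U : Set (V ⊕ V)} {G : SimpleGraph V}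
    (hU : ∀ a b, G.Adj a b → Sum.inl a ∉ U ∧ Sum.inr a ∉ U)
    (htr : ∀ v a b, G.Adj v a → G.Adj v b → a ≠ b → G.Adj a b)
    {f : MvPolynomial (V ⊕ V) K} (hf : tp K U G f = 0) : f ∈ bI K U G := by
  classical
  let L : MvPolynomial (V ⊕ (Set V ⊕ Set V)) K →ₗ[K] (MvPolynomial (V ⊕ V) K ⧸ bI K U G) :=
    (basisMonomials (V ⊕ (Set V ⊕ Set V)) K).constr K (fun e =>
      if h : ∃ m : (V ⊕ V) →₀ ℕ, (∀ s ∈ U, m s = 0) ∧ tE G m = e then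
        Ideal.Quotient.mk (bI K U G) (monomial h.choose 1) else 0)
  have hL : L ∘ₗ (tp K U G).toLinearMap = (Ideal.Quotient.mkₐ K (bI K U G)).toLinearMap := by
    refine (basisMonomials (V ⊕ V) K).ext fun m => ?_
    rw [coe_basisMonomials, LinearMap.comp_apply, AlgHom.toLinearMap_apply,
      AlgHom.toLinearMap_apply, Ideal.Quotient.mkₐ_eq_mk]
    by_cases hm : ∀ s ∈ U, m s = 0
    · rw [tp_monomial U G hm]
      have h1 : monomial (tE G m) (1 : K) = basisMonomials (V ⊕ (Set V ⊕ Set V)) K (tE G m) := by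
        rw [coe_basisMonomials]
      have hex : ∃ m' : (V ⊕ V) →₀ ℕ, (∀ s ∈ U, m' s = 0) ∧ tE G m' = tE G m := ⟨m, hm, rfl⟩
      rw [h1, Module.Basis.constr_basis, dif_pos hex, Ideal.Quotient.eq]
      exact mono_cong hU htr _ _ rfl hex.choose_spec.1 _ hm hex.choose_spec.2
    · push Not at hm
      obtain ⟨s, hs, hms⟩ := hm
      rw [tp_monomial_zero U G hs hms, map_zero, eq_comm, Ideal.Quotient.eq_zero_iff_mem]
      obtain ⟨m', rfl⟩ := split_single hms
      have e : monomial (Finsupp.single s 1 + m') (1 : K) = X s * monomial m' 1 := by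
        rw [X, monomial_mul, one_mul]
      beta_reduce
      rw [e]
      exact Ideal.mul_mem_right _ _ (X_mem_bI G hs)
  have := LinearMap.congr_fun hL f
  rw [LinearMap.comp_apply, AlgHom.toLinearMap_apply, hf, map_zero, AlgHom.toLinearMap_apply,
    Ideal.Quotient.mkₐ_eq_mk, eq_comm, Ideal.Quotient.eq_zero_iff_mem] at this
  exact this

theorem tp_of_mem {U : Set (V ⊕ V)} {G : SimpleGraph V}
    (hU : ∀ a b, G.Adj a b → Sum.inl a ∉ U ∧ Sum.inr a ∉ U)
    (htr : ∀ v a b, G.Adj v a → G.Adj v b → a ≠ b → G.Adj a b)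
    {f : MvPolynomial (V ⊕ V) K} (hf : f ∈ bI K U G) : tp K U G f = 0 := by
  have h : bI K U G ≤ RingHom.ker (tp K U G) := by
    refine bI_le ?_ ?_
    · intro s hs
      rw [RingHom.mem_ker, tp, aeval_X, if_pos hs]
    · intro a b hab
      have h1 := hU a b hab
      have h2 := hU b a hab.symm
      rw [RingHom.mem_ker, tp, map_sub, map_mul, map_mul, aeval_X, aeval_X, aeval_X, aeval_X,
        if_neg h1.1, if_neg h1.2, if_neg h2.1, if_neg h2.2, monomial_mul, monomial_mul, sub_eq_zero]
      congr 1
      simp only [te, cn_eq htr hab]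
      congr 1
      abel
  exact h hf

theorem X_regular {U : Set (V ⊕ V)} {G : SimpleGraph V}
    (hU : ∀ a b, G.Adj a b → Sum.inl a ∉ U ∧ Sum.inr a ∉ U)
    (htr : ∀ v a b, G.Adj v a → G.Adj v b → a ≠ b → G.Adj a b) {s : V ⊕ V} (hs : s ∉ U)
    (f : MvPolynomial (V ⊕ V) K) (hf : X s * f ∈ bI K U G) : f ∈ bI K U G := by
  have h := tp_of_mem hU htr hf
  rw [map_mul] at h
  refine mem_of_tp hU htr ((mul_eq_zero.1 h).resolve_left ?_)
  rw [tp, aeval_X, if_neg hs]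
  simp

end Toric

section Main

variable {V K : Type} [Fintype V] [DecidableEq V] [Field K]

theorem homI_bI (U : Set (V ⊕ V)) (G : SimpleGraph V) : HomI (bI K U G) := by
  refine homI_sup (homI_span ?_) (homI_span ?_)
  · rintro f ⟨a, b, _, rfl⟩
    exact ⟨1 + 1, ((isHomogeneous_X _ _).mul (isHomogeneous_X _ _)).sub
      ((isHomogeneous_X _ _).mul (isHomogeneous_X _ _))⟩
  · rintro f ⟨s, _, rfl⟩
    exact ⟨1, isHomogeneous_X _ _⟩

/-- the two variables at `v` -/
def pv (v : V) : Set (V ⊕ V) := {Sum.inl v, Sum.inr v}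

open Classical in
/-- set variables in `P` to zero -/
def ph (K : Type) [Field K] (P : Set (V ⊕ V)) : MvPolynomial (V ⊕ V) K →ₐ[K] MvPolynomial (V ⊕ V) K :=
  aeval (fun s => if s ∈ P then 0 else X s)

theorem ph_X_mem {P : Set (V ⊕ V)} {s : V ⊕ V} (h : s ∈ P) : ph K P (X s) = 0 := by
  rw [ph, aeval_X, if_pos h]

theorem ph_X_not {P : Set (V ⊕ V)} {s : V ⊕ V} (h : s ∉ P) : ph K P (X s) = X s := by
  rw [ph, aeval_X, if_neg h]

theorem sub_ph_mem (P : Set (V ⊕ V)) (h : MvPolynomial (V ⊕ V) K) :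
    h - ph K P h ∈ Ideal.span (X '' P : Set (MvPolynomial (V ⊕ V) K)) := by
  induction h using MvPolynomial.induction_on with
  | C a =>
    have : ph K P (C a) = C a := by rw [ph, aeval_C]; rfl
    rw [this, sub_self]; exact zero_mem _
  | add p q hp hq =>
    rw [map_add, add_sub_add_comm]; exact add_mem hp hq
  | mul_X p s hp =>
    rw [map_mul]
    by_cases hs : s ∈ P
    · rw [ph_X_mem hs, mul_zero, sub_zero]
      exact Ideal.mul_mem_left _ _ (Ideal.subset_span ⟨s, hs, rfl⟩)
    · rw [ph_X_not hs, ← sub_mul]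
      exact Ideal.mul_mem_right _ _ hp

theorem inter_le {T B : Ideal (MvPolynomial (V ⊕ V) K)} {P : Set (V ⊕ V)}
    {gs : Set (MvPolynomial (V ⊕ V) K)} (hT : T ≤ T.comap (ph K P))
    (hg : ∀ g ∈ gs, ph K P g = g ∧ ∀ s ∈ P, X s * g ∈ T) (hB : B ≤ T.comap (ph K P)) :
    (T ⊔ Ideal.span gs) ⊓ B ≤ T := by
  rintro f ⟨hf, hfB⟩
  have h1 : ph K P f ∈ T := hB hfB
  suffices h2 : f - ph K P f ∈ T by simpa using add_mem h2 h1
  obtain ⟨t, ht, a, ha, rfl⟩ := Submodule.mem_sup.1 hf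
  rw [map_add, add_sub_add_comm]
  refine add_mem (sub_mem ht (hT ht)) ?_
  have key : ∀ h, h * a - ph K P (h * a) ∈ T := by
    clear hf hfB h1
    induction ha using Submodule.span_induction with
    | mem g hgs =>
      intro h
      rw [map_mul, (hg g hgs).1, ← sub_mul]
      have h3 : Ideal.span (X '' P : Set (MvPolynomial (V ⊕ V) K)) ≤
          Submodule.comap (LinearMap.toSpanSingleton (MvPolynomial (V ⊕ V) K) _ g) T := by
        refine Ideal.span_le.2 ?_
        rintro _ ⟨s, hs, rfl⟩
        exact (hg g hgs).2 s hs
      exact h3 (sub_ph_mem P h)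
    | zero => intro h; simp
    | add x y _ _ hx hy =>
      intro h
      rw [mul_add, map_add, add_sub_add_comm]; exact add_mem (hx h) (hy h)
    | smul c x _ hx =>
      intro h
      rw [smul_eq_mul, ← mul_assoc]; exact hx _
  simpa using key 1

theorem edge_ph {G : SimpleGraph V} {J : Ideal (MvPolynomial (V ⊕ V) K)} (v : V) {a b : V}
    (h : a ≠ v → b ≠ v → X (Sum.inl a) * X (Sum.inr b) - X (Sum.inl b) * X (Sum.inr a) ∈ J) :
    ph K (pv v) (X (Sum.inl a) * X (Sum.inr b) - X (Sum.inl b) * X (Sum.inr a)) ∈ J := by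
  rw [map_sub, map_mul, map_mul]
  by_cases ha : a = v
  · subst ha
    rw [ph_X_mem (s := Sum.inl a) (by simp [pv]), ph_X_mem (s := Sum.inr a) (by simp [pv])]
    simp
  by_cases hb : b = v
  · subst hb
    rw [ph_X_mem (s := Sum.inl b) (by simp [pv]), ph_X_mem (s := Sum.inr b) (by simp [pv])]
    simp
  rw [ph_X_not (by simp [pv, ha]), ph_X_not (by simp [pv, hb]), ph_X_not (by simp [pv, hb]),
    ph_X_not (by simp [pv, ha])]
  exact h ha hb

theorem bI_ph (U : Set (V ⊕ V)) (G : SimpleGraph V) (v : V) :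
    bI K U G ≤ (bI K U G).comap (ph K (pv v)) := by
  refine bI_le ?_ ?_
  · intro s hs
    rw [Ideal.mem_comap]
    by_cases h : s ∈ pv v
    · rw [ph_X_mem h]; exact zero_mem _
    · rw [ph_X_not h]; exact X_mem_bI G hs
  · intro a b hab
    exact edge_ph (G := G) v fun _ _ => edge_mem_bI U hab

theorem bI_del_ph (U : Set (V ⊕ V)) (G : SimpleGraph V) (v : V) :
    bI K (U ∪ pv v) (del G {v}) ≤ (bI K U G).comap (ph K (pv v)) := by
  refine bI_le ?_ ?_
  · intro s hs
    rw [Ideal.mem_comap]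
    by_cases h : s ∈ pv v
    · rw [ph_X_mem h]; exact zero_mem _
    · rw [ph_X_not h]; exact X_mem_bI G (hs.resolve_right h)
  · intro a b hab
    exact edge_ph (G := G) v fun _ _ => edge_mem_bI U hab.1

theorem edge_mem_of_left {J : Ideal (MvPolynomial (V ⊕ V) K)} {a b : V} (h1 : X (Sum.inl a) ∈ J)
    (h2 : X (Sum.inr a) ∈ J) :
    X (Sum.inl a) * X (Sum.inr b) - X (Sum.inl b) * X (Sum.inr a) ∈ J :=
  sub_mem (Ideal.mul_mem_right _ _ h1) (Ideal.mul_mem_left _ _ h2)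

theorem edge_mem_of_right {J : Ideal (MvPolynomial (V ⊕ V) K)} {a b : V} (h1 : X (Sum.inl b) ∈ J)
    (h2 : X (Sum.inr b) ∈ J) :
    X (Sum.inl a) * X (Sum.inr b) - X (Sum.inl b) * X (Sum.inr a) ∈ J :=
  sub_mem (Ideal.mul_mem_left _ _ h2) (Ideal.mul_mem_right _ _ h1)

theorem edge_mem_of_inl {J : Ideal (MvPolynomial (V ⊕ V) K)} {a b : V} (h1 : X (Sum.inl a) ∈ J)
    (h2 : X (Sum.inl b) ∈ J) :
    X (Sum.inl a) * X (Sum.inr b) - X (Sum.inl b) * X (Sum.inr a) ∈ J :=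
  sub_mem (Ideal.mul_mem_right _ _ h1) (Ideal.mul_mem_right _ _ h2)

/-- `J_G ≤ (x_v, y_v) + J_{G - v}` -/
theorem bI_le_del {U U' : Set (V ⊕ V)} (G : SimpleGraph V) (v : V) (hUU : U ⊆ U' ∪ pv v) :
    bI K U G ≤ bI K (U' ∪ pv v) (del G {v}) := by
  have hl : X (Sum.inl v) ∈ bI K (U' ∪ pv v) (del G {v}) := X_mem_bI _ (Or.inr (by simp [pv]))
  have hr : X (Sum.inr v) ∈ bI K (U' ∪ pv v) (del G {v}) := X_mem_bI _ (Or.inr (by simp [pv]))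
  refine bI_le (fun s hs => X_mem_bI _ (hUU hs)) fun a b hab => ?_
  by_cases ha : a = v
  · subst ha; exact edge_mem_of_left hl hr
  by_cases hb : b = v
  · subst hb; exact edge_mem_of_right hl hr
  exact edge_mem_bI _ ⟨hab, ha, hb⟩

theorem ohtani (U : Set (V ⊕ V)) (G : SimpleGraph V) (v : V) :
    bI K U (cpl G v) ⊓ bI K (U ∪ pv v) (del G {v}) = bI K U G := by
  refine le_antisymm ?_ (le_inf ?_ ?_)
  · let gs : Set (MvPolynomial (V ⊕ V) K) := {f | ∃ a b, G.Adj v a ∧ G.Adj v b ∧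
      f = X (Sum.inl a) * X (Sum.inr b) - X (Sum.inl b) * X (Sum.inr a)}
    refine le_trans (inf_le_inf_right _ ?_) (inter_le (gs := gs) (bI_ph U G v) ?_ (bI_del_ph U G v))
    · refine bI_le (fun s hs => Ideal.mem_sup_left (X_mem_bI G hs)) ?_
      rintro a b (hab | ⟨_, ha, hb⟩)
      · exact Ideal.mem_sup_left (edge_mem_bI U hab)
      · exact Ideal.mem_sup_right (Ideal.subset_span ⟨a, b, ha, hb, rfl⟩)
    · rintro _ ⟨a, b, ha, hb, rfl⟩
      have hav := ha.ne.symm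
      have hbv := hb.ne.symm
      refine ⟨?_, ?_⟩
      · rw [map_sub, map_mul, map_mul, ph_X_not (by simp [pv, hav]), ph_X_not (by simp [pv, hbv]),
          ph_X_not (by simp [pv, hbv]), ph_X_not (by simp [pv, hav])]
      · have h1 := edge_mem_bI (K := K) U ha
        have h2 := edge_mem_bI (K := K) U hb
        rintro s (rfl | rfl)
        · have := sub_mem (Ideal.mul_mem_left _ (X (Sum.inl a)) h2)
            (Ideal.mul_mem_left _ (X (Sum.inl b)) h1)
          convert this using 1
          ring
        · have := sub_mem (Ideal.mul_mem_left _ (X (Sum.inr a)) h2)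
            (Ideal.mul_mem_left _ (X (Sum.inr b)) h1)
          convert this using 1
          ring
  · exact bI_le (fun s hs => X_mem_bI _ hs) fun a b hab => edge_mem_bI U (Or.inl hab)
  · exact bI_le_del G v Set.subset_union_left

theorem ohtani_sup (U : Set (V ⊕ V)) (G : SimpleGraph V) (v : V) :
    bI K U (cpl G v) ⊔ bI K (U ∪ pv v) (del G {v}) = bI K (U ∪ pv v) (del (cpl G v) {v}) := by
  refine le_antisymm (sup_le ?_ ?_) ?_
  · exact bI_le_del _ v Set.subset_union_left
  · exact bI_le (fun s hs => X_mem_bI _ hs) fun a b hab => edge_mem_bI _ ⟨Or.inl hab.1, hab.2⟩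
  · exact bI_le (fun s hs => Ideal.mem_sup_right (X_mem_bI _ hs))
      fun a b hab => Ideal.mem_sup_left (edge_mem_bI _ hab.1)

/-- `J_G ≤ (x_C) + J_{G - C}` for a clique component `C = N[v]` -/
theorem bI_le_delC {U U' : Set (V ⊕ V)} {G H : SimpleGraph V} (v : V)
    (htr : ∀ v a b, G.Adj v a → G.Adj v b → a ≠ b → G.Adj a b) (hHG : ∀ a b, H.Adj a b → G.Adj a b)
    (hUU : U ⊆ U')
    (hC : ∀ w ∈ cn G v, Sum.inl w ∈ U') :
    bI K U H ≤ bI K U' (del G (cn G v)) := by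
  refine bI_le (fun s hs => X_mem_bI _ (hUU hs)) fun a b hab => ?_
  have hab := hHG a b hab
  have key : ∀ a b, G.Adj a b → a ∈ cn G v → b ∈ cn G v := by
    rintro a b hab (rfl | h)
    · exact Or.inr hab
    · by_cases hb : b = v
      · exact Or.inl hb
      · exact Or.inr (htr a v b h.symm hab (Ne.symm hb))
  by_cases ha : a ∈ cn G v
  · exact edge_mem_of_inl (X_mem_bI _ (hC a ha)) (X_mem_bI _ (hC b (key a b hab ha)))
  · exact edge_mem_bI _ ⟨hab, ha, fun hb => ha (key b a hab.symm hb)⟩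

/-- x-variables of `N[v]` -/
def xC (G : SimpleGraph V) (v : V) : Set (V ⊕ V) := Sum.inl '' cn G v

theorem clq_inf (U : Set (V ⊕ V)) (G : SimpleGraph V) (v : V)
    (htr : ∀ v a b, G.Adj v a → G.Adj v b → a ≠ b → G.Adj a b) :
    bI K (U ∪ xC G v) (del G (cn G v)) ⊓ bI K (U ∪ pv v) (del G {v}) =
      bI K (insert (Sum.inl v) U) G := by
  have hvv : Sum.inl v ∈ xC G v := ⟨v, Or.inl rfl, rfl⟩
  refine le_antisymm ?_ (le_inf ?_ ?_)
  · let gs : Set (MvPolynomial (V ⊕ V) K) := {f | ∃ w, G.Adj v w ∧ f = X (Sum.inl w)}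
    have e : insert (Sum.inl v) U ∪ pv v = U ∪ pv v := by
      ext s; simp only [pv, Set.mem_union, Set.mem_insert_iff, Set.mem_singleton_iff]; tauto
    rw [← e]
    refine le_trans (inf_le_inf_right _ ?_) (inter_le (gs := gs) (bI_ph _ G v) ?_ (bI_del_ph _ G v))
    · refine bI_le ?_ fun a b hab => Ideal.mem_sup_left (edge_mem_bI _ hab.1)
      rintro s (hs | ⟨w, hw, rfl⟩)
      · exact Ideal.mem_sup_left (X_mem_bI G (Or.inr hs))
      · rcases hw with rfl | hw
        · exact Ideal.mem_sup_left (X_mem_bI G (Or.inl rfl))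
        · exact Ideal.mem_sup_right (Ideal.subset_span ⟨w, hw, rfl⟩)
    · rintro _ ⟨w, hw, rfl⟩
      have hwv := hw.ne.symm
      have hx : X (Sum.inl v) ∈ bI K (insert (Sum.inl v) U) G := X_mem_bI G (Or.inl rfl)
      refine ⟨ph_X_not (by simp [pv, hwv]), ?_⟩
      rintro s (rfl | rfl)
      · exact Ideal.mul_mem_right _ _ hx
      · have := sub_mem (Ideal.mul_mem_right (X (Sum.inr w)) _ hx)
          (edge_mem_bI (K := K) (insert (Sum.inl v) U) hw)
        convert this using 1
        ring
  · refine bI_le_delC v htr (fun _ _ h => h) ?_ fun w hw => Or.inr ⟨w, hw, rfl⟩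
    rintro s (rfl | hs)
    · exact Or.inr hvv
    · exact Or.inl hs
  · refine bI_le_del G v ?_
    rintro s (rfl | hs)
    · exact Or.inr (by simp [pv])
    · exact Or.inl hs

theorem clq_sup (U : Set (V ⊕ V)) (G : SimpleGraph V) (v : V)
    (htr : ∀ v a b, G.Adj v a → G.Adj v b → a ≠ b → G.Adj a b) :
    bI K (U ∪ xC G v) (del G (cn G v)) ⊔ bI K (U ∪ pv v) (del G {v}) =
      bI K (U ∪ xC G v ∪ pv v) (del G (cn G v)) := by
  refine le_antisymm (sup_le ?_ ?_) ?_
  · exact bI_le (fun s hs => X_mem_bI _ (Or.inl hs)) fun a b hab => edge_mem_bI _ hab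
  · refine bI_le_delC v htr (fun _ _ h => h.1) ?_ fun w hw => Or.inl (Or.inr ⟨w, hw, rfl⟩)
    rintro s (hs | hs)
    · exact Or.inl (Or.inl hs)
    · exact Or.inr hs
  · refine bI_le ?_ fun a b hab => Ideal.mem_sup_left (edge_mem_bI _ hab)
    rintro s (hs | hs)
    · exact Ideal.mem_sup_left (X_mem_bI _ hs)
    · exact Ideal.mem_sup_right (X_mem_bI _ (Or.inr hs))

theorem bI_insert (U : Set (V ⊕ V)) (G : SimpleGraph V) (s : V ⊕ V) :
    bI K (insert s U) G = bI K U G ⊔ Ideal.span {X s} := by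
  rw [bI, bI, Set.image_insert_eq, Set.insert_eq, Set.union_comm, Ideal.span_union, sup_assoc]

theorem reg_bot (N : ℕ) : ∀ U : Set (V ⊕ V), Uᶜ.ncard = N → RegLE (bI K U (⊥ : SimpleGraph V)) 0 := by
  induction N with
  | zero =>
    intro U hU
    rw [Set.ncard_eq_zero, Set.compl_empty_iff] at hU
    exact RegLE.of_max fun s => X_mem_bI _ (hU ▸ Set.mem_univ s)
  | succ N ih =>
    intro U hU
    obtain ⟨s, hs⟩ : Uᶜ.Nonempty := Set.nonempty_of_ncard_ne_zero (by omega)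
    refine RegLE.of_regular (homI_bI _ _) s (X_regular (by simp) (by simp) hs) ?_
    rw [← bI_insert]
    apply ih
    have : (insert s U)ᶜ = Uᶜ \ {s} := by
      ext t; simp only [Set.mem_compl_iff, Set.mem_insert_iff, Set.mem_diff, Set.mem_singleton_iff]
      tauto
    rw [this, Set.ncard_diff_singleton_of_mem hs]
    omega

/-- non-isolated vertices -/
def sup' (G : SimpleGraph V) : Set V := {v | ∃ w, G.Adj v w}

theorem supp_del {G : SimpleGraph V} {D : Set V} {v a : V} (h : G.Adj v a) (hv : v ∈ D) :
    (sup' (del G D)).ncard < (sup' G).ncard := by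
  refine Set.ncard_lt_ncard ?_ (Set.toFinite _)
  refine ⟨fun w ⟨x, hx⟩ => ⟨x, hx.1⟩, fun hsub => ?_⟩
  obtain ⟨x, hx⟩ := hsub (show v ∈ sup' G from ⟨a, h⟩)
  exact hx.2.1 hv

theorem supp_cpl (G : SimpleGraph V) (v : V) : sup' (cpl G v) = sup' G := by
  ext w
  constructor
  · rintro ⟨x, h | h⟩
    · exact ⟨x, h⟩
    · exact ⟨v, h.2.1.symm⟩
  · rintro ⟨x, h⟩
    exact ⟨x, Or.inl h⟩

/-- ordered non-edges -/
def ned (G : SimpleGraph V) : Set (V × V) := {p | ¬ G.Adj p.1 p.2}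

theorem ned_cpl {G : SimpleGraph V} {v a b : V} (ha : G.Adj v a) (hb : G.Adj v b)
    (hab : a ≠ b) (hn : ¬ G.Adj a b) : (ned (cpl G v)).ncard < (ned G).ncard := by
  refine Set.ncard_lt_ncard ?_ (Set.toFinite _)
  refine ⟨fun p hp h => hp (Or.inl h), fun hsub => ?_⟩
  exact hsub (show (a, b) ∈ ned G from hn) (Or.inr ⟨hab, ha, hb⟩)

theorem reg_main (N : ℕ) : ∀ M : ℕ, ∀ (U : Set (V ⊕ V)) (G : SimpleGraph V),
    (∀ a b, G.Adj a b → Sum.inl a ∉ U ∧ Sum.inr a ∉ U) → (sup' G).ncard = N → (ned G).ncard = M →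
    RegLE (bI K U G) (eta G) := by
  induction N using Nat.strong_induction_on with
  | _ N ihN =>
  intro M
  induction M using Nat.strong_induction_on with
  | _ M ihM =>
  intro U G hU hN hM
  have hdel : ∀ (G' : SimpleGraph V) (v : V), (∀ a b, G'.Adj a b → Sum.inl a ∉ U ∧ Sum.inr a ∉ U) →
      ∀ a b, (del G' {v}).Adj a b → Sum.inl a ∉ U ∪ pv v ∧ Sum.inr a ∉ U ∪ pv v := by
    intro G' v hU' a b hab
    have h1 := hU' a b hab.1
    have h2 : a ≠ v := hab.2.1
    simp [pv, h1, h2]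
  by_cases hns : ∃ v a b, G.Adj v a ∧ G.Adj v b ∧ a ≠ b ∧ ¬ G.Adj a b
  · obtain ⟨v, a, b, ha, hb, hab, hn⟩ := hns
    have hUc : ∀ a b, (cpl G v).Adj a b → Sum.inl a ∉ U ∧ Sum.inr a ∉ U := by
      rintro a b (h | h)
      · exact hU a b h
      · exact hU a v h.2.1.symm
    rw [← ohtani U G v]
    refine RegLE.inf (r' := eta (del (cpl G v) {v})) (homI_bI _ _) (homI_bI _ _) ?_ ?_ ?_
      (eta_cpl_del_lt ha hb hab hn _)
    · exact (ihM _ (hM ▸ ned_cpl ha hb hab hn) U (cpl G v) hUc (by rw [supp_cpl, hN]) rfl).mono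
        (eta_cpl_le ha)
    · exact (ihN _ (hN ▸ supp_del ha rfl) _ _ _ (hdel G v hU) rfl rfl).mono (eta_del_le _ _)
    · rw [ohtani_sup]
      refine ihN _ ?_ _ _ _ (hdel (cpl G v) v hUc) rfl rfl
      have := supp_del (G := cpl G v) (D := {v}) (v := v) (a := a) (Or.inl ha) rfl
      rwa [supp_cpl, hN] at this
  · push Not at hns
    have htr : ∀ v a b, G.Adj v a → G.Adj v b → a ≠ b → G.Adj a b := hns
    by_cases hbot : ∃ v a, G.Adj v a
    · obtain ⟨v, a, ha⟩ := hbot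
      have hvv : v ∈ cn G v := Or.inl rfl
      refine RegLE.of_regular (homI_bI _ _) (Sum.inl v) (X_regular hU htr (hU v a ha).1) ?_
      rw [← bI_insert, ← clq_inf U G v htr]
      have hlt := eta_del_cn_lt ha
      have hUa : ∀ a b, (del G (cn G v)).Adj a b →
          Sum.inl a ∉ U ∪ xC G v ∪ pv v ∧ Sum.inr a ∉ U ∪ xC G v ∪ pv v := by
        intro a b hab
        have h1 := hU a b hab.1
        have h2 : a ∉ cn G v := hab.2.1
        have h3 : a ≠ v := fun h => h2 (h ▸ hvv)
        simp [pv, xC, h1, h2, h3]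
      refine RegLE.inf (r' := eta (del G (cn G v))) (homI_bI _ _) (homI_bI _ _) ?_ ?_ ?_ hlt
      · refine (ihN _ (hN ▸ supp_del ha hvv) _ _ _ ?_ rfl rfl).mono (by omega)
        intro a b hab
        exact ⟨fun h => (hUa a b hab).1 (Or.inl h), fun h => (hUa a b hab).2 (Or.inl h)⟩
      · exact (ihN _ (hN ▸ supp_del ha rfl) _ _ _ (hdel G v hU) rfl rfl).mono (eta_del_le _ _)
      · rw [clq_sup U G v htr]
        exact ihN _ (hN ▸ supp_del ha hvv) _ _ _ hUa rfl rfl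
    · have : G = ⊥ := by
        ext a b
        simp only [SimpleGraph.bot_adj, iff_false]
        exact fun h => hbot ⟨a, b, h⟩
      subst this
      exact (reg_bot _ U rfl).mono (Nat.zero_le _)

theorem bI_empty (G : SimpleGraph V) : bI K ∅ G = binomialEdgeIdeal K G := by
  simp [bI]

theorem reg_zero : RegLE (⊥ : Ideal (MvPolynomial (V ⊕ V) K)) 0 := by
  have := reg_bot (V := V) (K := K) _ ∅ rfl
  have e : bI K ∅ (⊥ : SimpleGraph V) = ⊥ := by
    rw [eq_bot_iff]
    exact bI_le (by simp) (by simp)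
  rwa [e] at this

end Main

end BEI

/-- **A sharp general bound for the regularity of binomial edge ideals
(the Saeedi Madani–Kiani conjecture).**  For every graph `G` on `[n]`,
`reg (S/J_G) ≤ η(G)`; in particular (since `η(G) ≤ c(G)`)
`reg (S/J_G) ≤ c(G)`. -/
theorem reg_quotient_binomialEdgeIdeal_le_eta
    (K : Type) [Field K] (n : ℕ) (G : SimpleGraph (Fin n))
    (F : MinimalGradedFreeResolutionOfQuotient (binomialEdgeIdeal K G)) :
    F.reg ≤ eta G ∧ eta G ≤ maximalCliqueCount G ∧ F.reg ≤ maximalCliqueCount G := by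
  have h : F.reg ≤ eta G := by
    refine BEI.res_bound F BEI.reg_zero ?_
    rw [← BEI.bI_empty]
    exact BEI.reg_main _ _ _ _ (by simp) rfl rfl
  exact ⟨h, BEI.eta_le_count G, h.trans (BEI.eta_le_count G)⟩

end
end

section
/- Let G be a connected finite simple graph on the vertex set [n] and K a field. Then reg(S/J_G) ≤ n − dim Δ(G), where Δ(G) is the clique complex of G, i.e., the simplicial complex on [n] whose faces are the cliques of G, and dim Δ(G) is its dimension (one less than the maximal cardinality of a clique of G). -/
open MvPolynomial

noncomputable section

/-- The dimension of the clique complex `Δ(G)` of `G`: the faces of `Δ(G)` are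
the cliques of `G`, and the dimension is the maximal cardinality of a face
minus one. -/
def dimCliqueComplex {V : Type} (G : SimpleGraph V) : ℕ :=
  sSup {d : ℕ | ∃ C : Finset V, G.IsClique ↑C ∧ C.card = d + 1}

/-! ### Koszul data -/

theorem car_exists (K : Type) [Field K] (m : ℕ) :
    ∃ (N : Type) (_ : Fintype N) (_ : DecidableEq N) (A B : Fin m → Matrix N N K) (ε : N → K),
      ε ≠ 0 ∧ (∀ i, (A i).mulVec ε = 0) ∧ (∀ i j, A i * A j + A j * A i = 0) ∧
      (∀ i, A i * A i = 0) ∧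
      (∀ i j, A i * B j + B j * A i = if i = j then 1 else 0) := by
  induction m with
  | zero =>
    refine ⟨Unit, inferInstance, inferInstance, fun _ => 0, fun _ => 0, fun _ => 1, ?_, ?_, ?_, ?_, ?_⟩
    · intro h
      have := congrFun h ()
      simp at this
    all_goals intro i; exact i.elim0
  | succ m ih =>
    obtain ⟨N, _, _, A, B, ε, h0, h1, h2, h3, h4⟩ := ih
    refine ⟨N ⊕ N, inferInstance, inferInstance,
      Fin.cons (Matrix.fromBlocks 0 1 0 0) (fun i => Matrix.fromBlocks (A i) 0 0 (-A i)),
      Fin.cons (Matrix.fromBlocks 0 0 1 0) (fun i => Matrix.fromBlocks (B i) 0 0 (-B i)),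
      Sum.elim ε 0, ?_, ?_, ?_, ?_, ?_⟩
    · intro h
      apply h0
      ext b
      have := congrFun h (Sum.inl b)
      simpa using this
    · intro i
      refine Fin.cases ?_ (fun i => ?_) i
      · ext b
        rcases b with b | b <;> simp [Matrix.fromBlocks_mulVec]
      · ext b
        rcases b with b | b <;> simp [Matrix.fromBlocks_mulVec, h1]
    · intro i j
      refine Fin.cases ?_ (fun i => ?_) i <;> refine Fin.cases ?_ (fun j => ?_) j <;>
        simp [Matrix.fromBlocks_multiply, Matrix.fromBlocks_add, h2]
    · intro i
      refine Fin.cases ?_ (fun i => ?_) i <;>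
        simp [Matrix.fromBlocks_multiply, h3]
    · intro i j
      refine Fin.cases ?_ (fun i => ?_) i <;> refine Fin.cases ?_ (fun j => ?_) j
      · simp [Matrix.fromBlocks_multiply, Matrix.fromBlocks_add]
      · simp [Matrix.fromBlocks_multiply, Matrix.fromBlocks_add, (Fin.succ_ne_zero j).symm]
      · simp [Matrix.fromBlocks_multiply, Matrix.fromBlocks_add]
      · simp only [Fin.cons_succ, Matrix.fromBlocks_multiply, Matrix.fromBlocks_add, Fin.succ_inj]
        have := h4 i j
        split_ifs with h <;> simp [h] at this ⊢ <;> simp [this]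

structure Kos (σ K : Type) [Field K] where
  N : Type
  fin : Finite N
  d : (N → MvPolynomial σ K) →ₗ[MvPolynomial σ K] (N → MvPolynomial σ K)
  h : σ → (N → MvPolynomial σ K) →ₗ[MvPolynomial σ K] (N → MvPolynomial σ K)
  dd : ∀ z, d (d z) = 0
  hd : ∀ i z, d (h i z) + h i (d z) = (X i : MvPolynomial σ K) • z
  d_hom : ∀ z e, (∀ b, (z b).IsHomogeneous e) → ∀ b, (d z b).IsHomogeneous (e + 1)
  h_hom : ∀ i z e, (∀ b, (z b).IsHomogeneous e) → ∀ b, (h i z b).IsHomogeneous e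
  d_const : ∀ z b, constantCoeff (d z b) = 0
  ε : N → K
  ε_ne : ε ≠ 0
  d_ε : d (fun b => C (ε b)) = 0

def matLin {σ K N : Type} [Field K] [Fintype N] (A : Matrix N N K) :
    (N → MvPolynomial σ K) →ₗ[MvPolynomial σ K] (N → MvPolynomial σ K) :=
  (A.map C).mulVecLin

theorem matLin_apply {σ K N : Type} [Field K] [Fintype N] (A : Matrix N N K)
    (z : N → MvPolynomial σ K) (b : N) : matLin A z b = ∑ c, C (A b c) * z c := by
  simp [matLin, Matrix.mulVec, dotProduct]

theorem matLin_matLin {σ K N : Type} [Field K] [Fintype N] (A B : Matrix N N K)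
    (z : N → MvPolynomial σ K) : matLin A (matLin B z) = matLin (A * B) z := by
  simp [matLin, Matrix.map_mul]

theorem matLin_add {σ K N : Type} [Field K] [Fintype N] (A B : Matrix N N K)
    (z : N → MvPolynomial σ K) : matLin A z + matLin B z = matLin (A + B) z := by
  ext1 b
  simp [matLin_apply, add_mul, Finset.sum_add_distrib]

theorem matLin_hom {σ K N : Type} [Field K] [Fintype N] (A : Matrix N N K)
    (z : N → MvPolynomial σ K) (e : ℕ) (hz : ∀ b, (z b).IsHomogeneous e) (b : N) :
    (matLin A z b).IsHomogeneous e := by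
  rw [matLin_apply]
  apply IsHomogeneous.sum
  intro c _
  simpa using (isHomogeneous_C σ (A b c)).mul (hz c)

theorem kos_exists (σ K : Type) [Field K] [Fintype σ] : Nonempty (Kos σ K) := by
  classical
  obtain ⟨N, _, _, A', B', ε, h0, h1, h2, h3, h4⟩ := car_exists K (Fintype.card σ)
  let q := Fintype.equivFin σ
  let A : σ → Matrix N N K := fun i => A' (q i)
  let B : σ → Matrix N N K := fun i => B' (q i)
  have a4 : ∀ i j, A i * B j + B j * A i = if i = j then 1 else 0 := by
    intro i j
    simpa using h4 (q i) (q j)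
  let d : (N → MvPolynomial σ K) →ₗ[MvPolynomial σ K] (N → MvPolynomial σ K) :=
    ∑ i, (X i : MvPolynomial σ K) • matLin (A i)
  have hdef : ∀ z, d z = ∑ i, (X i : MvPolynomial σ K) • matLin (A i) z := by
    intro z
    simp [d]
  have m0 : ∀ z : N → MvPolynomial σ K, matLin (0 : Matrix N N K) z = 0 := by
    intro z; ext1 b; simp [matLin_apply]
  have m1 : ∀ z : N → MvPolynomial σ K, matLin (1 : Matrix N N K) z = z := by
    intro z; ext1 b; simp [matLin_apply, Matrix.one_apply]
  refine ⟨⟨N, inferInstance, d, fun i => matLin (B i), ?_, ?_, ?_, ?_, ?_, ε, h0, ?_⟩⟩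
  · intro z
    have e1 : d (d z) = ∑ i, ∑ j, (X i * X j : MvPolynomial σ K) • matLin (A i * A j) z := by
      rw [hdef (d z), hdef z]
      simp [matLin_matLin, Finset.smul_sum, smul_smul]
    rw [e1]
    rw [← Finset.sum_product']
    apply Finset.sum_involution (fun p _ => (p.2, p.1))
    · rintro ⟨i, j⟩ _
      have : (X j * X i : MvPolynomial σ K) = X i * X j := mul_comm _ _
      simp only [this, ← smul_add, matLin_add]
      rw [h2, m0, smul_zero]
    · rintro ⟨i, j⟩ _ hne heq
      apply hne
      simp only [Prod.mk.injEq] at heq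
      obtain ⟨rfl, -⟩ := heq
      change _ • matLin (A' _ * A' _) z = 0
      rw [h3, m0, smul_zero]
    · simp
    · simp
  · intro i z
    rw [hdef, hdef, map_sum, ← Finset.sum_add_distrib]
    simp only [map_smul, matLin_matLin, ← smul_add, matLin_add, a4]
    rw [Finset.sum_eq_single i]
    · simp [m1]
    · intro j _ hj
      simp [hj, m0]
    · simp
  · intro z e hz b
    rw [hdef]
    simp only [Finset.sum_apply, Pi.smul_apply, smul_eq_mul]
    apply IsHomogeneous.sum
    intro i _
    rw [add_comm]
    exact (isHomogeneous_X K i).mul (matLin_hom _ z e hz b)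
  · intro i z e hz b
    exact matLin_hom _ z e hz b
  · intro z b
    rw [hdef]
    simp
  · rw [hdef]
    apply Finset.sum_eq_zero
    intro i _
    have : matLin (A i) (fun b => (C (ε b) : MvPolynomial σ K)) = 0 := by
      ext1 b
      rw [matLin_apply]
      have := congrFun (h1 (q i)) b
      simp only [Matrix.mulVec, dotProduct, Pi.zero_apply] at this
      simp only [← C_mul, ← map_sum, Pi.zero_apply]
      rw [show ∑ x, A i b x * ε x = 0 from this, C_0]
    rw [this, smul_zero]

def KReg {σ K : Type} [Field K] (k : Kos σ K) (I : Ideal (MvPolynomial σ K)) (e : ℕ) : Prop :=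
  ∀ z : k.N → MvPolynomial σ K, (∀ b, (z b).IsHomogeneous (e + 1)) → (∀ b, k.d z b ∈ I) →
    ∃ w : k.N → MvPolynomial σ K, (∀ b, (w b).IsHomogeneous e) ∧ ∀ b, z b - k.d w b ∈ I

def HomI {σ K : Type} [Field K] (I : Ideal (MvPolynomial σ K)) : Prop :=
  ∀ p ∈ I, ∀ n, homogeneousComponent n p ∈ I

theorem HomI_span {σ K : Type} [Field K] (s : Set (MvPolynomial σ K))
    (hs : ∀ p ∈ s, ∃ n, p.IsHomogeneous n) : HomI (Ideal.span s) := by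
  intro p hp n
  let := gradedAlgebra (σ := σ) (R := K)
  have := Ideal.homogeneous_span (homogeneousSubmodule σ K) s (by
    intro x hx
    obtain ⟨n, hn⟩ := hs x hx
    exact ⟨n, hn⟩)
  have h2 := this n hp
  rw [← decomposition.decompose'_apply]
  exact h2

theorem map_mem {σ K : Type} [Field K] (k : Kos σ K) {I : Ideal (MvPolynomial σ K)}
    (f : (k.N → MvPolynomial σ K) →ₗ[MvPolynomial σ K] (k.N → MvPolynomial σ K))
    {z : k.N → MvPolynomial σ K} (hz : ∀ b, z b ∈ I) (b : k.N) : f z b ∈ I := by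
  have := k.fin
  exact Ideal.map_pi I z hz f b

theorem hc_self {σ K : Type} [Field K] {p : MvPolynomial σ K} {n : ℕ} (h : p.IsHomogeneous n) :
    homogeneousComponent n p = p := by
  rw [homogeneousComponent_of_mem (m := n) (n := n) h, if_pos rfl]

theorem KReg_inf {σ K : Type} [Field K] (k : Kos σ K) {I J : Ideal (MvPolynomial σ K)} {e : ℕ}
    (hI : HomI I) (hJ : HomI J)
    (h1 : KReg k I (e + 1)) (h2 : KReg k J (e + 1)) (h3 : KReg k (I ⊔ J) e) :
    KReg k (I ⊓ J) (e + 1) := by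
  intro z hz hdz
  obtain ⟨w1, hw1, hz1⟩ := h1 z hz (fun b => (hdz b).1)
  obtain ⟨w2, hw2, hz2⟩ := h2 z hz (fun b => (hdz b).2)
  obtain ⟨u, hu, hwu⟩ := h3 (w1 - w2) (fun b => (hw1 b).sub (hw2 b)) (by
    intro b
    have : k.d (w1 - w2) b = (z b - k.d w2 b) - (z b - k.d w1 b) := by
      simp
    rw [this]
    exact sub_mem (Ideal.mem_sup_right (hz2 b)) (Ideal.mem_sup_left (hz1 b)))
  have key : ∀ b, ∃ p, p.IsHomogeneous (e + 1) ∧ p ∈ I ∧ (w1 - w2) b - k.d u b - p ∈ J := by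
    intro b
    obtain ⟨p, hp, q, hq, hpq⟩ := Submodule.mem_sup.1 (hwu b)
    refine ⟨homogeneousComponent (e + 1) p, homogeneousComponent_isHomogeneous _ _, hI p hp _, ?_⟩
    have hh : ((w1 - w2) b - k.d u b).IsHomogeneous (e + 1) :=
      ((hw1 b).sub (hw2 b)).sub (k.d_hom u e hu b)
    have := hc_self hh
    rw [← hpq, map_add] at this
    rw [← hpq, ← this, add_sub_cancel_left]
    exact hJ q hq _
  choose p hp hpI hpJ using key
  refine ⟨w1 - k.d u - p, fun b => ((hw1 b).sub (k.d_hom u e hu b)).sub (hp b), fun b => ⟨?_, ?_⟩⟩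
  · have : z b - k.d (w1 - k.d u - p) b = (z b - k.d w1 b) + k.d p b := by
      simp [k.dd]; ring
    rw [this]
    exact add_mem (hz1 b) (map_mem k k.d hpI b)
  · have hm := map_mem k k.d (z := (w1 - w2) - k.d u - p) hpJ b
    have : z b - k.d (w1 - k.d u - p) b = (z b - k.d w2 b) - k.d ((w1 - w2) - k.d u - p) b := by
      simp [k.dd]; ring
    rw [this]
    exact sub_mem (hz2 b) hm

theorem sup_split {σ K : Type} [Field K] {I : Ideal (MvPolynomial σ K)} {e : ℕ}
    (hI : HomI I) (i : σ) {y : MvPolynomial σ K} (hy : y.IsHomogeneous (e + 1))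
    (hm : y ∈ I ⊔ Ideal.span {X i}) :
    ∃ b, b.IsHomogeneous e ∧ y - X i * b ∈ I := by
  classical
  obtain ⟨p, hp, q, hq, hpq⟩ := Submodule.mem_sup.1 hm
  obtain ⟨c, rfl⟩ := Ideal.mem_span_singleton.1 hq
  refine ⟨homogeneousComponent e c, homogeneousComponent_isHomogeneous _ _, ?_⟩
  have h1 := hc_self hy
  have h2 : homogeneousComponent (e + 1) (X i * c) = X i * homogeneousComponent e c := by
    ext m
    rw [coeff_homogeneousComponent, coeff_X_mul', coeff_X_mul']
    by_cases him : i ∈ m.support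
    · simp only [him, if_true, coeff_homogeneousComponent]
      have : m.degree = (m - Finsupp.single i 1).degree + 1 := by
        have hle : Finsupp.single i 1 ≤ m := by
          rw [Finsupp.single_le_iff]
          exact Nat.one_le_iff_ne_zero.2 (Finsupp.mem_support_iff.1 him)
        conv_lhs => rw [← tsub_add_cancel_of_le hle]
        simp
      simp [this]
    · simp [him]
  rw [← hpq, map_add, h2] at h1
  rw [← hpq, ← h1, add_sub_cancel_right]
  exact hI p hp _

/-- nonzerodivisor lemma -/
theorem KReg_nzd {σ K : Type} [Field K] (k : Kos σ K) {I : Ideal (MvPolynomial σ K)} {e : ℕ}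
    (hI : HomI I) (i : σ) (hnz : ∀ f, X i * f ∈ I → f ∈ I)
    (h1 : KReg k (I ⊔ Ideal.span {X i}) e) : KReg k I e := by
  intro z hz hdz
  obtain ⟨w, hw, hzw⟩ := h1 z hz (fun b => Ideal.mem_sup_left (hdz b))
  have key := fun b => sup_split hI i ((hz b).sub (k.d_hom w e hw b)) (hzw b)
  choose p hp hpI using key
  have hdp : ∀ b, k.d p b ∈ I := by
    intro b
    apply hnz
    have hm := map_mem k k.d (z := z - k.d w - (X i : MvPolynomial σ K) • p)
      (fun b => by simpa using hpI b) b
    have : X i * k.d p b = k.d z b - k.d (z - k.d w - (X i : MvPolynomial σ K) • p) b := by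
      simp [k.dd]
    rw [this]
    exact sub_mem (hdz b) hm
  refine ⟨w + k.h i p, fun b => (hw b).add (k.h_hom i p e hp b), fun b => ?_⟩
  have h3 := congrFun (k.hd i p) b
  have : z b - k.d (w + k.h i p) b = (z b - k.d w b - X i * p b) + k.h i (k.d p) b := by
    simp at h3 ⊢
    rw [← h3]; ring
  rw [this]
  exact add_mem (hpI b) (map_mem k (k.h i) hdp b)

theorem KReg_colon {σ K : Type} [Field K] (k : Kos σ K) {I Q : Ideal (MvPolynomial σ K)} {e : ℕ}
    (hI : HomI I) (i : σ) (hQ : ∀ f, X i * f ∈ I ↔ f ∈ Q)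
    (h1 : KReg k (I ⊔ Ideal.span {X i}) (e + 1)) (h2 : KReg k Q e) : KReg k I (e + 1) := by
  intro z hz hdz
  obtain ⟨w, hw, hzw⟩ := h1 z hz (fun b => Ideal.mem_sup_left (hdz b))
  have key := fun b => sup_split hI i ((hz b).sub (k.d_hom w _ hw b)) (hzw b)
  choose p hp hpI using key
  have hdp : ∀ b, k.d p b ∈ Q := by
    intro b
    rw [← hQ]
    have hm := map_mem k k.d (z := z - k.d w - (X i : MvPolynomial σ K) • p)
      (fun b => by simpa using hpI b) b
    have : X i * k.d p b = k.d z b - k.d (z - k.d w - (X i : MvPolynomial σ K) • p) b := by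
      simp [k.dd]
    rw [this]
    exact sub_mem (hdz b) hm
  obtain ⟨c, hc, hpc⟩ := h2 p hp hdp
  refine ⟨w + (X i : MvPolynomial σ K) • c, fun b => (hw b).add ?_, fun b => ?_⟩
  · rw [add_comm]
    exact (isHomogeneous_X K i).mul (hc b)
  have : z b - k.d (w + (X i : MvPolynomial σ K) • c) b
      = (z b - k.d w b - X i * p b) + X i * (p b - k.d c b) := by
    simp; ring
  rw [this]
  exact add_mem (hpI b) ((hQ _).2 (hpc b))

set_option linter.unusedSectionVars false
set_option linter.unusedSimpArgs false
/-! ### Ideals generated by variables and 2-minors -/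

def bI (K : Type) [Field K] {V : Type} (T : Set (V ⊕ V)) (r : V → V → Prop) :
    Ideal (MvPolynomial (V ⊕ V) K) :=
  Ideal.span ((X '' T) ∪ {f | ∃ i j, r i j ∧
    f = X (Sum.inl i) * X (Sum.inr j) - X (Sum.inl j) * X (Sum.inr i)})

theorem bI_X {K : Type} [Field K] {V : Type} {T : Set (V ⊕ V)} {r : V → V → Prop} {t : V ⊕ V}
    (ht : t ∈ T) : (X t : MvPolynomial (V ⊕ V) K) ∈ bI K T r :=
  Ideal.subset_span (Or.inl ⟨t, ht, rfl⟩)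

theorem bI_f {K : Type} [Field K] {V : Type} {T : Set (V ⊕ V)} {r : V → V → Prop} {i j : V}
    (h : r i j) : (X (Sum.inl i) * X (Sum.inr j) - X (Sum.inl j) * X (Sum.inr i) :
      MvPolynomial (V ⊕ V) K) ∈ bI K T r :=
  Ideal.subset_span (Or.inr ⟨i, j, h, rfl⟩)

theorem bI_le {K : Type} [Field K] {V : Type} {T : Set (V ⊕ V)} {r : V → V → Prop}
    {I : Ideal (MvPolynomial (V ⊕ V) K)} (h1 : ∀ t ∈ T, X t ∈ I)
    (h2 : ∀ i j, r i j → X (Sum.inl i) * X (Sum.inr j) - X (Sum.inl j) * X (Sum.inr i) ∈ I) :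
    bI K T r ≤ I := by
  refine Ideal.span_le.2 ?_
  rintro f (⟨t, ht, rfl⟩ | ⟨i, j, h, rfl⟩)
  · exact h1 t ht
  · exact h2 i j h

theorem bI_hom {K : Type} [Field K] {V : Type} (T : Set (V ⊕ V)) (r : V → V → Prop) :
    HomI (bI K T r) := by
  apply HomI_span
  rintro f (⟨t, ht, rfl⟩ | ⟨i, j, h, rfl⟩)
  · exact ⟨1, isHomogeneous_X K t⟩
  · exact ⟨2, ((isHomogeneous_X K _).mul (isHomogeneous_X K _)).sub
      ((isHomogeneous_X K _).mul (isHomogeneous_X K _))⟩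

theorem bI_insert {K : Type} [Field K] {V : Type} (T : Set (V ⊕ V)) (r : V → V → Prop)
    (t : V ⊕ V) : bI K T r ⊔ Ideal.span {X t} = bI K (insert t T) r := by
  apply le_antisymm
  · apply sup_le
    · exact bI_le (fun s hs => bI_X (Or.inr hs)) (fun i j h => bI_f h)
    · rw [Ideal.span_singleton_le_iff_mem]
      exact bI_X (Or.inl rfl)
  · apply bI_le
    · rintro s (rfl | hs)
      · exact Ideal.mem_sup_right (Ideal.mem_span_singleton_self _)
      · exact Ideal.mem_sup_left (bI_X hs)
    · intro i j h
      exact Ideal.mem_sup_left (bI_f h)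

section toric
variable {V : Type} [Fintype V] [DecidableEq V]

def gw (c : V → V) : V ⊕ V → ((V ⊕ V) ⊕ V →₀ ℕ)
  | Sum.inl v => Finsupp.single (Sum.inl (Sum.inl (c v))) 1 + Finsupp.single (Sum.inr v) 1
  | Sum.inr v => Finsupp.single (Sum.inl (Sum.inr (c v))) 1 + Finsupp.single (Sum.inr v) 1

def W (c : V → V) (m : V ⊕ V →₀ ℕ) : (V ⊕ V) ⊕ V →₀ ℕ := ∑ t, m t • gw c t

theorem W_z (c : V → V) (m : V ⊕ V →₀ ℕ) (v : V) :
    W c m (Sum.inr v) = m (Sum.inl v) + m (Sum.inr v) := by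
  simp [W, gw, Finsupp.single_apply]

theorem W_s (c : V → V) (m : V ⊕ V →₀ ℕ) (l : V) :
    W c m (Sum.inl (Sum.inl l)) = ∑ v, if c v = l then m (Sum.inl v) else 0 := by
  simp [W, gw, Finsupp.single_apply]

theorem W_add (c : V → V) (m m' : V ⊕ V →₀ ℕ) : W c (m + m') = W c m + W c m' := by
  simp [W, add_smul, Finset.sum_add_distrib]

theorem W_single (c : V → V) (t : V ⊕ V) (n : ℕ) : W c (Finsupp.single t n) = n • gw c t := by
  rw [W, Finset.sum_eq_single t]
  · simp
  · intro s _ hs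
    simp [Finsupp.single_apply, hs.symm]
  · simp

theorem toric_exchange (K : Type) [Field K] (T : Set (V ⊕ V)) (c : V → V) (N : ℕ) :
    ∀ m m' : V ⊕ V →₀ ℕ, W c m = W c m' → (∑ v, (m (Sum.inl v) - m' (Sum.inl v))) = N →
    (monomial m 1 - monomial m' 1 : MvPolynomial (V ⊕ V) K) ∈ bI K T (fun i j => c i = c j) := by
  induction N with
  | zero =>
    intro m m' hW hN
    have h1 : ∀ v, m (Sum.inl v) ≤ m' (Sum.inl v) := by
      intro v
      have := (Finset.sum_eq_zero_iff.1 hN) v (Finset.mem_univ v)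
      omega
    have h2 : ∀ v, m (Sum.inl v) = m' (Sum.inl v) := by
      intro v
      have h3 := W_s c m (c v)
      rw [hW, W_s] at h3
      have h4 := (Finset.sum_eq_sum_iff_of_le (s := Finset.univ)
        (f := fun u => if c u = c v then m (Sum.inl u) else 0)
        (g := fun u => if c u = c v then m' (Sum.inl u) else 0)
        (by intro u _; split_ifs <;> simp [h1])).1 h3.symm v (Finset.mem_univ v)
      simpa using h4
    have h5 : m = m' := by
      ext t
      rcases t with v | v
      · exact h2 v
      · have h3 := W_z c m v
        rw [hW, W_z, h2 v] at h3
        omega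
    rw [h5, sub_self]
    exact zero_mem _
  | succ N ih =>
    intro m m' hW hN
    obtain ⟨i, hi⟩ : ∃ i, m' (Sum.inl i) < m (Sum.inl i) := by
      by_contra hcon
      push Not at hcon
      rw [Finset.sum_eq_zero] at hN
      · omega
      · intro v _
        have := hcon v
        omega
    obtain ⟨j, hj, hcj⟩ : ∃ j, m (Sum.inl j) < m' (Sum.inl j) ∧ c j = c i := by
      by_contra hcon
      push Not at hcon
      have h3 := W_s c m (c i)
      rw [hW, W_s] at h3
      have : ∑ v, (if c v = c i then m' (Sum.inl v) else 0)
          < ∑ v, (if c v = c i then m (Sum.inl v) else 0) := by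
        apply Finset.sum_lt_sum
        · intro v _
          split_ifs with hv
          · by_contra hlt
            exact hcon v (by omega) hv
          · exact le_rfl
        · exact ⟨i, Finset.mem_univ i, by simpa using hi⟩
      omega
    have hij : i ≠ j := by rintro rfl; omega
    have hyj : 1 ≤ m (Sum.inr j) := by
      have h3 := W_z c m j
      rw [hW, W_z] at h3
      omega
    obtain ⟨m0, hm0⟩ : ∃ m0, m = Finsupp.single (Sum.inl i) 1 + Finsupp.single (Sum.inr j) 1 + m0 := by
      refine ⟨m - (Finsupp.single (Sum.inl i) 1 + Finsupp.single (Sum.inr j) 1), ?_⟩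
      rw [add_tsub_cancel_of_le]
      intro t
      rcases t with v | v
      · by_cases hv : i = v
        · subst hv; simp; omega
        · simp [Finsupp.single_apply, hv]
      · by_cases hv : j = v
        · subst hv; simp; omega
        · simp [Finsupp.single_apply, hv]
    set m2 := Finsupp.single (Sum.inl j) 1 + Finsupp.single (Sum.inr i) 1 + m0 with hm2
    have hW2 : W c m2 = W c m' := by
      rw [← hW, hm0, hm2]
      simp only [W_add, W_single, gw, hcj, one_smul]
      abel
    have hsum : ∑ v, (m2 (Sum.inl v) - m' (Sum.inl v)) = N := by
      have h1 : ∀ v, m2 (Sum.inl v) - m' (Sum.inl v) + (if i = v then 1 else 0)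
          = m (Sum.inl v) - m' (Sum.inl v) := by
        intro v
        rw [hm0] at hi hj ⊢
        by_cases hv : i = v
        · subst hv
          simp [hm2, Finsupp.single_apply, hij.symm] at hi ⊢
          omega
        · by_cases hv2 : j = v
          · subst hv2
            simp [hm2, Finsupp.single_apply, hv] at hj ⊢
            omega
          · simp [hm2, Finsupp.single_apply, hv, hv2]
      have h2 : ∑ v, (m2 (Sum.inl v) - m' (Sum.inl v)) + 1 = N + 1 := by
        rw [← hN, ← Finset.sum_congr rfl (fun v _ => h1 v), Finset.sum_add_distrib]
        simp
      omega
    have h7 := ih m2 m' hW2 hsum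
    have h8 : (monomial m 1 - monomial m' 1 : MvPolynomial (V ⊕ V) K) =
        monomial m0 1 * (X (Sum.inl i) * X (Sum.inr j) - X (Sum.inl j) * X (Sum.inr i)) +
        (monomial m2 1 - monomial m' 1) := by
      rw [hm0, hm2]
      simp only [X, mul_sub, monomial_mul, one_mul]
      rw [add_comm _ m0, add_comm _ m0]
      ring
    rw [h8]
    exact add_mem (Ideal.mul_mem_left _ _ (bI_f hcj.symm)) h7

open Classical in
def toricHom (K : Type) [Field K] (T : Set (V ⊕ V)) (c : V → V) :
    MvPolynomial (V ⊕ V) K →ₐ[K] MvPolynomial ((V ⊕ V) ⊕ V) K :=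
  aeval (fun t => if t ∈ T then 0 else monomial (gw c t) 1)

theorem toric_alive (K : Type) [Field K] (T : Set (V ⊕ V)) (c : V → V) (m : V ⊕ V →₀ ℕ)
    (h : ∀ t ∈ T, m t = 0) : toricHom K T c (monomial m 1) = monomial (W c m) 1 := by
  classical
  rw [toricHom, aeval_monomial, map_one, one_mul, Finsupp.prod_fintype _ _ (by simp), W,
    monomial_sum_one]
  apply Finset.prod_congr rfl
  intro t _
  by_cases ht : t ∈ T
  · simp [h t ht]
  · simp [ht, monomial_pow]

theorem toric_dead (K : Type) [Field K] (T : Set (V ⊕ V)) (c : V → V) (m : V ⊕ V →₀ ℕ)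
    (t : V ⊕ V) (ht : t ∈ T) (hm : m t ≠ 0) : toricHom K T c (monomial m 1) = 0 := by
  classical
  rw [toricHom, aeval_monomial, map_one, one_mul, Finsupp.prod_fintype _ _ (by simp)]
  apply Finset.prod_eq_zero (Finset.mem_univ t)
  simp [ht, hm]

theorem toric_ker (K : Type) [Field K] (T : Set (V ⊕ V)) (c : V → V)
    (f : MvPolynomial (V ⊕ V) K) (hf : toricHom K T c f = 0) :
    f ∈ bI K T (fun i j => c i = c j) := by
  classical
  set I := bI K T (fun i j => c i = c j)
  let ψ : MvPolynomial ((V ⊕ V) ⊕ V) K →ₗ[K] (MvPolynomial (V ⊕ V) K ⧸ I) :=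
    (basisMonomials _ K).constr K (fun μ =>
      if h : ∃ m, (∀ t ∈ T, m t = 0) ∧ W c m = μ then
        Ideal.Quotient.mk I (monomial h.choose 1) else 0)
  have key : ψ.comp (toricHom K T c).toLinearMap = (Ideal.Quotient.mkₐ K I).toLinearMap := by
    apply (basisMonomials _ K).ext
    intro m
    simp only [coe_basisMonomials, LinearMap.comp_apply, AlgHom.toLinearMap_apply,
      Ideal.Quotient.mkₐ_eq_mk]
    by_cases hm : ∀ t ∈ T, m t = 0
    · rw [toric_alive K T c m hm]
      have hex : ∃ m', (∀ t ∈ T, m' t = 0) ∧ W c m' = W c m := ⟨m, hm, rfl⟩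
      have : ψ (monomial (W c m) 1) = Ideal.Quotient.mk I (monomial hex.choose 1) := by
        have := (basisMonomials ((V ⊕ V) ⊕ V) K).constr_basis K (fun μ =>
          if h : ∃ m, (∀ t ∈ T, m t = 0) ∧ W c m = μ then
          Ideal.Quotient.mk I (monomial h.choose 1) else 0) (W c m)
        rw [dif_pos hex] at this
        rw [← this, coe_basisMonomials]
      rw [this]
      exact Ideal.Quotient.eq.2 (toric_exchange K T c _ _ _ hex.choose_spec.2 rfl)
    · push Not at hm
      obtain ⟨t, ht, hmt⟩ := hm
      rw [toric_dead K T c m t ht hmt, map_zero]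
      symm
      rw [Ideal.Quotient.eq_zero_iff_mem]
      have hle : Finsupp.single t 1 ≤ m := by
        rw [Finsupp.single_le_iff]; omega
      rw [← tsub_add_cancel_of_le hle, show (monomial (m - Finsupp.single t 1 + Finsupp.single t 1) 1
        : MvPolynomial (V ⊕ V) K) = monomial (m - Finsupp.single t 1) 1 * X t by
          simp [X, monomial_mul]]
      exact Ideal.mul_mem_left _ _ (bI_X ht)
  have h1 := LinearMap.congr_fun key f
  simp only [LinearMap.comp_apply, AlgHom.toLinearMap_apply, hf, map_zero] at h1
  exact Ideal.Quotient.eq_zero_iff_mem.1 h1.symm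

def Compat (T : Set (V ⊕ V)) (c : V → V) : Prop :=
  ∀ i j, i ≠ j → c i = c j → ((Sum.inl i ∈ T ∨ Sum.inr j ∈ T) ↔ (Sum.inl j ∈ T ∨ Sum.inr i ∈ T))

theorem toric_ker_iff (K : Type) [Field K] (T : Set (V ⊕ V)) (c : V → V) (hc : Compat T c)
    (f : MvPolynomial (V ⊕ V) K) :
    f ∈ bI K T (fun i j => c i = c j) ↔ toricHom K T c f = 0 := by
  classical
  refine ⟨fun h => ?_, toric_ker K T c f⟩
  have hX : ∀ t, toricHom K T c (X t) = if t ∈ T then 0 else monomial (gw c t) 1 := by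
    intro t; simp [toricHom]
  have : bI K T (fun i j => c i = c j) ≤ RingHom.ker (toricHom K T c) := by
    apply bI_le
    · intro t ht
      rw [RingHom.mem_ker, hX, if_pos ht]
    · intro i j hij
      rw [RingHom.mem_ker, map_sub, map_mul, map_mul, hX, hX, hX, hX]
      by_cases hne : i = j
      · subst hne; simp
      have := hc i j hne hij
      by_cases h1 : Sum.inl i ∈ T ∨ Sum.inr j ∈ T
      · have h2 := this.1 h1
        have e1 : ∀ (p q : Prop) [Decidable p] [Decidable q]
          (a b : MvPolynomial ((V ⊕ V) ⊕ V) K), p ∨ q →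
          (if p then 0 else a) * (if q then 0 else b) = 0 := by
          intro p q _ _ a b h
          rcases h with h | h <;> simp [h]
        rw [e1 _ _ _ _ h1, e1 _ _ _ _ h2, sub_zero]
      · have h2 : ¬ (Sum.inl j ∈ T ∨ Sum.inr i ∈ T) := fun h => h1 (this.2 h)
        push Not at h1 h2
        rw [if_neg h1.1, if_neg h1.2, if_neg h2.1, if_neg h2.2]
        simp only [monomial_mul, gw, hij]
        rw [sub_eq_zero]
        congr 1
        abel
  exact this h

theorem toric_nzd (K : Type) [Field K] (T : Set (V ⊕ V)) (c : V → V) (hc : Compat T c)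
    (t : V ⊕ V) (ht : t ∉ T) (f : MvPolynomial (V ⊕ V) K)
    (h : X t * f ∈ bI K T (fun i j => c i = c j)) : f ∈ bI K T (fun i j => c i = c j) := by
  classical
  rw [toric_ker_iff K T c hc] at h ⊢
  rw [map_mul] at h
  rcases mul_eq_zero.1 h with h | h
  · exfalso
    simp [toricHom, ht] at h
  · exact h

end toric

/-! ### The base case: disjoint unions of cliques -/

section base
variable {V : Type} [Fintype V] [DecidableEq V]

theorem bI_congr {K : Type} [Field K] {T : Set (V ⊕ V)} {r s : V → V → Prop}
    (h1 : ∀ i j, r i j → X (Sum.inl i) * X (Sum.inr j) - X (Sum.inl j) * X (Sum.inr i) ∈ bI K T s)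
    (h2 : ∀ i j, s i j → X (Sum.inl i) * X (Sum.inr j) - X (Sum.inl j) * X (Sum.inr i) ∈ bI K T r) :
    bI K T r = bI K T s :=
  le_antisymm (bI_le (fun _ ht => bI_X ht) h1) (bI_le (fun _ ht => bI_X ht) h2)

theorem base_case (K : Type) [Field K] (k : Kos (V ⊕ V) K) (N : ℕ) :
    ∀ (T : Finset (V ⊕ V)) (c : V → V) (R : Finset V) (e : ℕ), (Tᶜ).card ≤ N →
      Compat (T : Set (V ⊕ V)) c →
      (∀ i j, i ≠ j → c i = c j → Sum.inl i ∉ T → Sum.inl j ∉ T → Sum.inr i ∉ T → Sum.inr j ∉ T →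
        c i ∈ R) → R.card ≤ e → KReg k (bI K (T : Set (V ⊕ V)) (fun i j => c i = c j)) e := by
  induction N with
  | zero =>
    intro T c R e hT _ _ _ z hz _
    refine ⟨0, fun b => isHomogeneous_zero _ _ _, fun b => ?_⟩
    have hT2 : ∀ t, t ∈ T := by
      intro t
      by_contra h
      have := Finset.card_pos.2 ⟨t, Finset.mem_compl.2 h⟩
      omega
    have h1 : z b ∈ Ideal.span ((X : V ⊕ V → MvPolynomial (V ⊕ V) K) '' Set.univ) := by
      rw [mem_ideal_span_X_image]
      intro m hm
      by_contra hcon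
      push Not at hcon
      have h0 : m = 0 := by ext t; simpa using hcon t (Set.mem_univ t)
      have := (hz b) (mem_support_iff.1 hm)
      rw [h0] at this
      simp at this
    have h2 : Ideal.span ((X : V ⊕ V → MvPolynomial (V ⊕ V) K) '' Set.univ) ≤
        bI K (T : Set (V ⊕ V)) (fun i j => c i = c j) := by
      rw [Ideal.span_le]
      rintro _ ⟨t, _, rfl⟩
      exact bI_X (hT2 t)
    simpa using h2 h1
  | succ N ih =>
    intro T c R e hT hc hR he
    have hcard : ∀ (T' : Finset (V ⊕ V)) (t : V ⊕ V), T ⊆ T' → t ∈ T' → t ∉ T → (T'ᶜ).card ≤ N := by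
      intro T' t hTT ht1 ht2
      have : T'ᶜ ⊂ Tᶜ := by
        rw [Finset.compl_ssubset_compl]
        exact ⟨hTT, fun h => ht2 (h ht1)⟩
      have := Finset.card_lt_card this
      omega
    by_cases hnt : ∃ i j, i ≠ j ∧ c i = c j ∧ Sum.inl i ∉ T ∧ Sum.inl j ∉ T ∧ Sum.inr i ∉ T ∧
        Sum.inr j ∉ T
    · obtain ⟨i, j, hij, hcij, hxi, hxj, hyi, hyj⟩ := hnt
      have hiR := hR i j hij hcij hxi hxj hyi hyj
      have hRpos := Finset.card_pos.2 ⟨_, hiR⟩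
      obtain ⟨e, rfl⟩ : ∃ e', e = e' + 1 := ⟨e - 1, by omega⟩
      apply KReg_nzd k (bI_hom _ _) (Sum.inl i) (toric_nzd K _ c hc _ hxi)
      rw [bI_insert]
      let P : Finset (V ⊕ V) := T ∪ (Finset.univ.filter (fun v => c v = c i)).image Sum.inl
      have hP1 : ∀ v, Sum.inl v ∈ P ↔ (Sum.inl v ∈ T ∨ c v = c i) := by
        intro v; simp [P]
      have hP2 : ∀ v, Sum.inr v ∈ P ↔ Sum.inr v ∈ T := by
        intro v; simp [P]
      have hTP : T ⊆ P := Finset.subset_union_left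
      have hPc : Compat (P : Set (V ⊕ V)) c := by
        intro a b hab hcab
        have := hc a b hab hcab
        simp only [Finset.mem_coe, hP1, hP2] at this ⊢
        rw [hcab]
        tauto
      apply KReg_colon k (bI_hom _ _) (Sum.inr i)
        (Q := bI K (P : Set (V ⊕ V)) (fun i j => c i = c j))
      · intro f
        constructor
        · intro hf
          apply toric_nzd K _ c hPc (Sum.inr i)
          · simp only [Finset.mem_coe, hP2]; exact hyi
          · refine bI_le ?_ (fun a b h => bI_f h) hf
            rintro t (rfl | ht)
            · exact bI_X (by simp [hP1])
            · exact bI_X (hTP ht)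
        · intro hf
          set I' := bI K (insert (Sum.inl i) (T : Set (V ⊕ V))) (fun i j => c i = c j) with hI'
          have : bI K (P : Set (V ⊕ V)) (fun i j => c i = c j) ≤
              Submodule.comap (LinearMap.mulLeft (MvPolynomial (V ⊕ V) K) (X (Sum.inr i))) I' := by
            apply bI_le
            · intro t ht
              rw [Submodule.mem_comap, LinearMap.mulLeft_apply]
              rcases t with v | v
              · rw [Finset.mem_coe, hP1] at ht
                rcases ht with ht | ht
                · exact Ideal.mul_mem_left _ _ (bI_X (Or.inr ht))
                · have h1 : (X (Sum.inr i) * X (Sum.inl v) : MvPolynomial (V ⊕ V) K) =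
                    (X (Sum.inl v) * X (Sum.inr i) - X (Sum.inl i) * X (Sum.inr v)) +
                    X (Sum.inr v) * X (Sum.inl i) := by ring
                  rw [h1]
                  exact add_mem (bI_f ht) (Ideal.mul_mem_left _ _ (bI_X (Or.inl rfl)))
              · rw [Finset.mem_coe, hP2] at ht
                exact Ideal.mul_mem_left _ _ (bI_X (Or.inr ht))
            · intro a b h
              rw [Submodule.mem_comap, LinearMap.mulLeft_apply]
              exact Ideal.mul_mem_left _ _ (bI_f h)
          exact this hf
      · rw [bI_insert]
        have := ih (insert (Sum.inr i) (insert (Sum.inl i) T)) c R (e + 1)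
          (hcard _ (Sum.inl i) (fun t ht => by simp [ht]) (by simp) hxi) ?_ ?_ he
        · simpa using this
        · intro a b hab hcab
          have := hc a b hab hcab
          simp only [Finset.mem_coe] at this
          simp only [Finset.coe_insert, Set.mem_insert_iff, Finset.mem_coe, Sum.inl.injEq,
            Sum.inr.injEq, reduceCtorEq, false_or]
          tauto
        · intro a b hab hcab h1 h2 h3 h4
          simp only [Finset.mem_insert, not_or] at h1 h2 h3 h4
          exact hR a b hab hcab h1.2.2 h2.2.2 h3.2.2 h4.2.2
      · apply ih P c (R.erase (c i)) e (hcard P (Sum.inl i) hTP (by simp [hP1]) hxi) hPc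
        · intro a b hab hcab h1 h2 h3 h4
          simp only [hP1, hP2, not_or] at h1 h2 h3 h4
          exact Finset.mem_erase.2 ⟨h1.2, hR a b hab hcab h1.1 h2.1 h3 h4⟩
        · rw [Finset.card_erase_of_mem hiR]
          omega
    · push Not at hnt
      have hid : bI K (T : Set (V ⊕ V)) (fun i j => c i = c j) =
          bI K (T : Set (V ⊕ V)) (fun i j => id i = id j) := by
        apply bI_congr
        · intro i j hij
          by_cases hne : i = j
          · subst hne; rw [sub_self]; exact zero_mem _
          have h1 := hc i j hne hij
          have h2 := hnt i j hne hij
          simp only [Finset.mem_coe] at h1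
          have h3 : (Sum.inl i ∈ T ∨ Sum.inr j ∈ T) ∧ (Sum.inl j ∈ T ∨ Sum.inr i ∈ T) := by tauto
          apply sub_mem
          · rcases h3.1 with h | h
            · exact Ideal.mul_mem_right _ _ (bI_X h)
            · exact Ideal.mul_mem_left _ _ (bI_X h)
          · rcases h3.2 with h | h
            · exact Ideal.mul_mem_right _ _ (bI_X h)
            · exact Ideal.mul_mem_left _ _ (bI_X h)
        · intro i j hij
          obtain rfl : i = j := hij
          rw [sub_self]; exact zero_mem _
      have hcid : ∀ T' : Set (V ⊕ V), Compat T' (id : V → V) := by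
        intro T' a b hab h
        exact absurd h hab
      rw [hid]
      by_cases hall : ∃ t, t ∉ T
      · obtain ⟨t, ht⟩ := hall
        apply KReg_nzd k (bI_hom _ _) t (toric_nzd K _ id (hcid _) _ ht)
        rw [bI_insert]
        have := ih (insert t T) id ∅ e (hcard _ t (Finset.subset_insert _ _) (by simp) ht) (hcid _)
          (fun a b hab h => absurd h hab) (by simp)
        simpa using this
      · push Not at hall
        exact ih T id ∅ e (by
          have : Tᶜ = ∅ := by ext t; simp [hall t]
          simp [this]) (hcid _) (fun a b hab h => absurd h hab) (by simp)

theorem KReg_bot (K : Type) [Field K] (k : Kos (V ⊕ V) K) (e : ℕ) :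
    KReg k (⊥ : Ideal (MvPolynomial (V ⊕ V) K)) e := by
  have := base_case K k _ (∅ : Finset (V ⊕ V)) id ∅ e le_rfl
    (fun a b hab h => absurd h hab) (fun a b hab h => absurd h hab) (by simp)
  have h2 : bI K ((∅ : Finset (V ⊕ V)) : Set (V ⊕ V)) (fun i j => id i = id j) = ⊥ := by
    rw [eq_bot_iff]
    apply bI_le
    · intro t ht; simp at ht
    · intro i j hij
      obtain rfl : i = j := hij
      simp
  rwa [h2] at this

end base

/-! ### Comparison with a minimal resolution -/

def bdry {σ K : Type} [Field K] {I : Ideal (MvPolynomial σ K)}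
    (F : MinimalGradedFreeResolutionOfQuotient I) {N : Type} (i : ℕ)
    (u : Fin (F.rank (i + 1)) → N → MvPolynomial σ K) : Fin (F.rank i) → N → MvPolynomial σ K :=
  fun r => ∑ c, F.diff i r c • u c

def augm {σ K : Type} [Field K] {I : Ideal (MvPolynomial σ K)}
    (F : MinimalGradedFreeResolutionOfQuotient I) {N : Type}
    (u : Fin (F.rank 0) → N → MvPolynomial σ K) : N → MvPolynomial σ K :=
  ∑ c, F.gen c • u c

theorem bdry_apply {σ K : Type} [Field K] {I : Ideal (MvPolynomial σ K)}
    (F : MinimalGradedFreeResolutionOfQuotient I) {N : Type} (i : ℕ)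
    (u : Fin (F.rank (i + 1)) → N → MvPolynomial σ K) (r) (b : N) :
    bdry F i u r b = (F.diff i).mulVec (fun c => u c b) r := by
  simp [bdry, Matrix.mulVec, dotProduct]

theorem augm_apply {σ K : Type} [Field K] {I : Ideal (MvPolynomial σ K)}
    (F : MinimalGradedFreeResolutionOfQuotient I) {N : Type}
    (u : Fin (F.rank 0) → N → MvPolynomial σ K) (b : N) :
    augm F u b = ∑ c, u c b * F.gen c := by
  simp [augm, mul_comm]

theorem d_bdry {σ K : Type} [Field K] {I : Ideal (MvPolynomial σ K)}
    (F : MinimalGradedFreeResolutionOfQuotient I) (k : Kos σ K) (i : ℕ)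
    (u : Fin (F.rank (i + 1)) → k.N → MvPolynomial σ K) (r) :
    k.d (bdry F i u r) = bdry F i (fun c => k.d (u c)) r := by
  simp [bdry]

theorem d_augm {σ K : Type} [Field K] {I : Ideal (MvPolynomial σ K)}
    (F : MinimalGradedFreeResolutionOfQuotient I) (k : Kos σ K)
    (u : Fin (F.rank 0) → k.N → MvPolynomial σ K) :
    k.d (augm F u) = augm F (fun c => k.d (u c)) := by
  simp [augm]

theorem bdry_bdry {σ K : Type} [Field K] {I : Ideal (MvPolynomial σ K)}
    (F : MinimalGradedFreeResolutionOfQuotient I) {N : Type} (i : ℕ)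
    (u : Fin (F.rank (i + 1 + 1)) → N → MvPolynomial σ K) (r) :
    bdry F i (bdry F (i + 1) u) r = 0 := by
  ext1 b
  rw [bdry_apply]
  have : (F.diff i).mulVec (fun c => bdry F (i + 1) u c b) = 0 := by
    rw [F.exact_succ]
    exact ⟨fun c => u c b, by ext1 c; rw [bdry_apply]⟩
  rw [this]; rfl

theorem augm_bdry {σ K : Type} [Field K] {I : Ideal (MvPolynomial σ K)}
    (F : MinimalGradedFreeResolutionOfQuotient I) {N : Type}
    (u : Fin (F.rank (0 + 1)) → N → MvPolynomial σ K) (b : N) :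
    augm F (bdry F 0 u) b ∈ I := by
  rw [augm_apply, F.exact_zero]
  exact ⟨fun c => u c b, by ext1 c; rw [bdry_apply]⟩

theorem exists_bdry {σ K : Type} [Field K] {I : Ideal (MvPolynomial σ K)}
    (F : MinimalGradedFreeResolutionOfQuotient I) {N : Type} (i : ℕ)
    (u : Fin (F.rank (i + 1)) → N → MvPolynomial σ K) (h : ∀ r, bdry F i u r = 0) :
    ∃ w, u = bdry F (i + 1) w := by
  have key : ∀ b, ∃ w, (fun c => u c b) = (F.diff (i + 1)).mulVec w := by
    intro b
    rw [← F.exact_succ]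
    ext1 r
    rw [← bdry_apply, h]; rfl
  choose w hw using key
  refine ⟨fun c b => w b c, ?_⟩
  ext1 c; ext1 b
  rw [bdry_apply]
  exact congrFun (hw b) c

theorem exists_bdry_zero {σ K : Type} [Field K] {I : Ideal (MvPolynomial σ K)}
    (F : MinimalGradedFreeResolutionOfQuotient I) {N : Type}
    (u : Fin (F.rank 0) → N → MvPolynomial σ K) (h : ∀ b, augm F u b ∈ I) :
    ∃ w, u = bdry F 0 w := by
  have key : ∀ b, ∃ w, (fun c => u c b) = (F.diff 0).mulVec w := by
    intro b
    rw [← F.exact_zero, ← augm_apply]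
    exact h b
  choose w hw using key
  refine ⟨fun c b => w b c, ?_⟩
  ext1 c; ext1 b
  rw [bdry_apply]
  exact congrFun (hw b) c

def Wt {σ K : Type} [Field K] (p : MvPolynomial σ K) (a D : ℕ) : Prop :=
  p = 0 ∨ ∃ m, p.IsHomogeneous m ∧ m + a = D

theorem Wt.sum {σ K ι : Type} [Field K] (s : Finset ι) (p : ι → MvPolynomial σ K) (a D : ℕ)
    (h : ∀ i ∈ s, Wt (p i) a D) : Wt (∑ i ∈ s, p i) a D := by
  by_cases hD : a ≤ D
  · right
    refine ⟨D - a, IsHomogeneous.sum _ _ _ (fun i hi => ?_), by omega⟩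
    rcases h i hi with h | ⟨m, hm, rfl⟩
    · rw [h]; exact isHomogeneous_zero _ _ _
    · simpa using hm
  · left
    apply Finset.sum_eq_zero
    intro i hi
    rcases h i hi with h | ⟨m, hm, rfl⟩
    · exact h
    · omega

theorem chase {σ K : Type} [Field K] {I : Ideal (MvPolynomial σ K)}
    (F : MinimalGradedFreeResolutionOfQuotient I) (k : Kos σ K) (e : ℕ)
    (hbot : ∀ e, KReg k (⊥ : Ideal (MvPolynomial σ K)) e) (hI : KReg k I e) (D : ℕ) :
    ∀ (j q : ℕ), q + j + e + 1 = D → ∀ u : Fin (F.rank j) → k.N → MvPolynomial σ K,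
      (∀ c b, Wt (u c b) (F.twist j c + q) D) →
      (∀ hj : j = 0, ∀ b, k.d (augm F (hj ▸ u)) b ∈ I) →
      (∀ j' (hj : j = j' + 1), ∀ r, k.d (bdry F j' (hj ▸ u) r) = 0) →
      ∃ (w0 : Fin (F.rank j) → k.N → MvPolynomial σ K)
        (w1 : Fin (F.rank (j + 1)) → k.N → MvPolynomial σ K),
        ∀ c, u c = k.d (w0 c) + bdry F j w1 c := by
  intro j
  induction j with
  | zero =>
    intro q hq u hu h0 _
    have h0 := h0 rfl
    simp only at h0
    obtain ⟨w, hw, hzw⟩ := hI (augm F u) (by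
      intro b
      rw [augm_apply]
      apply IsHomogeneous.sum
      intro c _
      rcases hu c b with h | ⟨m, hm, hmD⟩
      · rw [h, zero_mul]; exact isHomogeneous_zero _ _ _
      · have := hm.mul (F.gen_homog c)
        rwa [show m + F.twist 0 c = e + 1 by omega] at this) h0
    have hl := fun b => F.gen_span (w b)
    choose w' hw' using hl
    let w0 : Fin (F.rank 0) → k.N → MvPolynomial σ K := fun c b => w' b c
    have hw0 : ∀ b, (w - augm F w0) b ∈ I := by
      intro b
      have := hw' b
      rw [Pi.sub_apply, augm_apply]
      exact this
    obtain ⟨w1, hw1⟩ := exists_bdry_zero F (fun c => u c - k.d (w0 c)) (by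
      intro b
      have h1 : augm F (fun c => u c - k.d (w0 c)) b
          = (augm F u b - k.d w b) + k.d (w - augm F w0) b := by
        rw [map_sub, d_augm]
        simp [augm_apply, sub_mul, Finset.sum_sub_distrib]
      rw [h1]
      exact add_mem (hzw b) (map_mem k k.d hw0 b))
    refine ⟨w0, w1, fun c => ?_⟩
    rw [← hw1]; simp
  | succ j ih =>
    intro q hq u hu _ h1
    have h1 := h1 j rfl
    simp only at h1
    have key : ∀ r, ∃ u' : k.N → MvPolynomial σ K, (∀ b, Wt (u' b) (F.twist j r + (q + 1)) D) ∧
        bdry F j u r = k.d u' := by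
      intro r
      have hconst : ∀ b, constantCoeff (bdry F j u r b) = 0 := by
        intro b
        simp [bdry, F.minimal]
      have hwt : ∀ b, Wt (bdry F j u r b) (F.twist j r + q) D := by
        intro b
        simp only [bdry, Finset.sum_apply, Pi.smul_apply, smul_eq_mul]
        apply Wt.sum
        intro c _
        rcases F.diff_homog j r c with h | ⟨hle, h⟩
        · left; rw [h, zero_mul]
        · rcases hu c b with h' | ⟨m, hm, hmD⟩
          · left; rw [h', mul_zero]
          · right
            exact ⟨_, h.mul hm, by omega⟩
      by_cases hlt : F.twist j r + q + 1 ≤ D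
      · obtain ⟨w, hw, hz⟩ := hbot (D - (F.twist j r + q + 1)) (bdry F j u r) (by
          intro b
          rcases hwt b with h | ⟨m, hm, hmD⟩
          · rw [h]; exact isHomogeneous_zero _ _ _
          · rwa [show D - (F.twist j r + q + 1) + 1 = m by omega]) (by
          intro b
          rw [h1 r]; simp)
        refine ⟨w, fun b => Or.inr ⟨_, hw b, by omega⟩, ?_⟩
        ext1 b
        exact sub_eq_zero.1 (by simpa using hz b)
      · refine ⟨0, fun b => Or.inl rfl, ?_⟩
        rw [map_zero]
        ext1 b
        rcases hwt b with h | ⟨m, hm, hmD⟩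
        · exact h
        · obtain rfl : m = 0 := by omega
          have h3 := (totalDegree_eq_zero_iff_eq_C (p := bdry F j u r b)).1
            (Nat.le_zero.1 hm.totalDegree_le)
          rw [h3]
          have h4 := hconst b
          rw [constantCoeff_eq] at h4
          rw [h4, C_0]; rfl
    choose u' hu' hdu' using key
    obtain ⟨w0, w1, hw⟩ := ih (q + 1) (by omega) u' hu' (by
      rintro rfl b
      simp only
      rw [d_augm]
      have : (fun c => k.d (u' c)) = bdry F 0 u := by
        ext1 c; rw [hdu']
      rw [this]
      exact augm_bdry F u b) (by
      rintro j' rfl r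
      simp only
      rw [d_bdry]
      have : (fun c => k.d (u' c)) = bdry F (j' + 1) u := by
        ext1 c; rw [hdu']
      rw [this]
      exact bdry_bdry F j' u r)
    obtain ⟨w2, hw2⟩ := exists_bdry F j (fun c => u c - k.d (w1 c)) (by
      intro r
      have h2 : bdry F j (fun c => u c - k.d (w1 c)) r
          = bdry F j u r - k.d (bdry F j w1 r) := by
        rw [d_bdry]
        simp [bdry, smul_sub, Finset.sum_sub_distrib]
      rw [h2, hdu', hw r, map_add, k.dd]
      simp)
    refine ⟨w1, w2, fun c => ?_⟩
    rw [← hw2]; simp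

theorem twist_ne {σ K : Type} [Field K] {I : Ideal (MvPolynomial σ K)}
    (F : MinimalGradedFreeResolutionOfQuotient I) (k : Kos σ K) (e : ℕ)
    (hbot : ∀ e, KReg k (⊥ : Ideal (MvPolynomial σ K)) e) (hI : KReg k I e) (i : ℕ)
    (t : Fin (F.rank i)) : F.twist i t ≠ (e + 1) + i := by
  classical
  intro ht
  obtain ⟨w0, w1, hw⟩ := chase F k e hbot hI ((e + 1) + i) i 0 (by omega)
    (fun c => if c = t then (fun b => C (k.ε b)) else 0) (by
      intro c b
      by_cases h : c = t
      · subst h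
        right
        refine ⟨0, ?_, by omega⟩
        simp only [if_true]
        exact isHomogeneous_C _ _
      · left; simp [h]) (by
      rintro rfl b
      simp only
      rw [d_augm]
      have : (fun c => k.d (if c = t then (fun b => C (k.ε b)) else 0)) = 0 := by
        ext1 c
        split_ifs
        · rw [k.d_ε]; rfl
        · simp
      rw [this]
      simp [augm]) (by
      rintro j rfl r
      simp only
      rw [d_bdry]
      have : (fun c => k.d (if c = t then (fun b => C (k.ε b)) else 0)) = 0 := by
        ext1 c
        split_ifs
        · rw [k.d_ε]; rfl
        · simp
      rw [this]
      simp [bdry])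
  apply k.ε_ne
  ext1 b
  have h1 := congrArg constantCoeff (congrFun (hw t) b)
  simp [bdry, F.minimal, k.d_const] at h1
  simpa using h1

/-! ### Ohtani's lemma and the main induction -/

section main
variable {V : Type} [Fintype V] [DecidableEq V]

def TU (U : Finset V) : Finset (V ⊕ V) := Finset.univ.filter (fun t => Sum.elim id id t ∈ U)

theorem TU_inl (U : Finset V) (v : V) : Sum.inl v ∈ TU U ↔ v ∈ U := by simp [TU]

theorem TU_inr (U : Finset V) (v : V) : Sum.inr v ∈ TU U ↔ v ∈ U := by simp [TU]

def rAdd (r : V → V → Prop) (v : V) (i j : V) : Prop := r i j ∨ (i ≠ j ∧ r v i ∧ r v j)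

def rDel (r : V → V → Prop) (v : V) (i j : V) : Prop := r i j ∧ i ≠ v ∧ j ≠ v

def killHom (K : Type) [Field K] (v : V) :
    MvPolynomial (V ⊕ V) K →ₐ[K] MvPolynomial (V ⊕ V) K :=
  aeval (fun t => if Sum.elim id id t = v then 0 else X t)

theorem killHom_X (K : Type) [Field K] (v : V) (t : V ⊕ V) :
    killHom K v (X t) = if Sum.elim id id t = v then 0 else X t := by
  simp [killHom]

theorem killHom_sub (K : Type) [Field K] (v : V) (p : MvPolynomial (V ⊕ V) K) :
    p - killHom K v p ∈ Ideal.span {X (Sum.inl v), X (Sum.inr v)} := by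
  induction p using MvPolynomial.induction_on with
  | C a => simp [killHom]
  | add p q hp hq =>
    rw [map_add, add_sub_add_comm]
    exact add_mem hp hq
  | mul_X p t hp =>
    rw [map_mul, killHom_X]
    split_ifs with h
    · rw [mul_zero, sub_zero]
      apply Ideal.mul_mem_left
      apply Ideal.subset_span
      rcases t with t | t <;> simp at h <;> simp [h]
    · rw [← sub_mul]
      exact Ideal.mul_mem_right _ _ hp

theorem ohtani (K : Type) [Field K] (U : Finset V) (r : V → V → Prop)
    (hs : ∀ i j, r i j → r j i) (v : V) :
    bI K (TU U : Set (V ⊕ V)) r =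
      bI K (TU U : Set (V ⊕ V)) (rAdd r v) ⊓ bI K (TU (insert v U) : Set (V ⊕ V)) (rDel r v) := by
  have hIA : bI K (TU U : Set (V ⊕ V)) r ≤ bI K (TU U : Set (V ⊕ V)) (rAdd r v) :=
    bI_le (fun t ht => bI_X ht) (fun i j h => bI_f (Or.inl h))
  apply le_antisymm
  · apply le_inf hIA
    apply bI_le
    · intro t ht
      apply bI_X
      simp only [TU, Finset.coe_filter, Set.mem_setOf_eq, Finset.mem_univ, true_and,
        Finset.mem_insert] at ht ⊢
      exact Or.inr ht
    · intro i j h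
      by_cases hi : i = v
      · subst hi
        exact sub_mem (Ideal.mul_mem_right _ _ (bI_X (by simp [TU_inl])))
          (Ideal.mul_mem_left _ _ (bI_X (by simp [TU_inr])))
      by_cases hj : j = v
      · subst hj
        exact sub_mem (Ideal.mul_mem_left _ _ (bI_X (by simp [TU_inr])))
          (Ideal.mul_mem_right _ _ (bI_X (by simp [TU_inl])))
      exact bI_f ⟨h, hi, hj⟩
  · rintro g ⟨hgA, hgB⟩
    set I := bI K (TU U : Set (V ⊕ V)) r with hIdef
    have hπB : killHom K v g ∈ I := by
      have : bI K (TU (insert v U) : Set (V ⊕ V)) (rDel r v) ≤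
          Ideal.comap (killHom K v) I := by
        apply bI_le
        · intro t ht
          rw [Ideal.mem_comap, killHom_X]
          split_ifs with h
          · exact zero_mem _
          · apply bI_X
            simp only [TU, Finset.coe_filter, Set.mem_setOf_eq, Finset.mem_univ, true_and,
              Finset.mem_insert, h, false_or] at ht ⊢
            exact ht
        · rintro i j ⟨h, hi, hj⟩
          rw [Ideal.mem_comap, map_sub, map_mul, map_mul]
          simp only [killHom_X, Sum.elim_inl, Sum.elim_inr, id_eq, hi, hj, if_false]
          exact bI_f h
      exact this hgB
    have hmul : ∀ t : V ⊕ V, Sum.elim id id t = v →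
        ∀ p ∈ bI K (TU U : Set (V ⊕ V)) (rAdd r v), X t * p ∈ I := by
      intro t ht p hp
      have : bI K (TU U : Set (V ⊕ V)) (rAdd r v) ≤
          Submodule.comap (LinearMap.mulLeft (MvPolynomial (V ⊕ V) K) (X t)) I := by
        apply bI_le
        · intro s hs
          exact Ideal.mul_mem_left _ _ (bI_X hs)
        · rintro i j (h | ⟨hne, hi, hj⟩)
          · exact Ideal.mul_mem_left _ _ (bI_f h)
          · rw [Submodule.mem_comap, LinearMap.mulLeft_apply]
            have f1 : X (Sum.inl v) * X (Sum.inr i) - X (Sum.inl i) * X (Sum.inr v) ∈ I := bI_f hi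
            have f2 : X (Sum.inl v) * X (Sum.inr j) - X (Sum.inl j) * X (Sum.inr v) ∈ I := bI_f hj
            rcases t with t | t
            · obtain rfl : t = v := ht
              have : (X (Sum.inl t) * (X (Sum.inl i) * X (Sum.inr j) - X (Sum.inl j) * X (Sum.inr i))
                : MvPolynomial (V ⊕ V) K) =
                X (Sum.inl i) * (X (Sum.inl t) * X (Sum.inr j) - X (Sum.inl j) * X (Sum.inr t)) -
                X (Sum.inl j) * (X (Sum.inl t) * X (Sum.inr i) - X (Sum.inl i) * X (Sum.inr t)) := by
                ring
              rw [this]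
              exact sub_mem (Ideal.mul_mem_left _ _ f2) (Ideal.mul_mem_left _ _ f1)
            · obtain rfl : t = v := ht
              have : (X (Sum.inr t) * (X (Sum.inl i) * X (Sum.inr j) - X (Sum.inl j) * X (Sum.inr i))
                : MvPolynomial (V ⊕ V) K) =
                X (Sum.inr i) * (X (Sum.inl t) * X (Sum.inr j) - X (Sum.inl j) * X (Sum.inr t)) -
                X (Sum.inr j) * (X (Sum.inl t) * X (Sum.inr i) - X (Sum.inl i) * X (Sum.inr t)) := by
                ring
              rw [this]
              exact sub_mem (Ideal.mul_mem_left _ _ f2) (Ideal.mul_mem_left _ _ f1)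
      exact this hp
    have hmul2 : ∀ q ∈ Ideal.span {X (Sum.inl v), X (Sum.inr v)},
        ∀ p ∈ bI K (TU U : Set (V ⊕ V)) (rAdd r v), q * p ∈ I := by
      intro q hq p hp
      obtain ⟨a, b, rfl⟩ := Ideal.mem_span_pair.1 hq
      have : (a * X (Sum.inl v) + b * X (Sum.inr v)) * p =
        a * (X (Sum.inl v) * p) + b * (X (Sum.inr v) * p) := by ring
      rw [this]
      exact add_mem (Ideal.mul_mem_left _ _ (hmul _ rfl p hp))
        (Ideal.mul_mem_left _ _ (hmul _ rfl p hp))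
    have hdiff : g - killHom K v g ∈ I := by
      clear hgB hπB
      unfold bI at hgA
      induction hgA using Submodule.span_induction with
      | zero => simp
      | add x y _ _ hx hy =>
        rw [map_add, add_sub_add_comm]
        exact add_mem hx hy
      | smul a x hx hx2 =>
        have hxA : x ∈ bI K (TU U : Set (V ⊕ V)) (rAdd r v) := hx
        have hkA : killHom K v x ∈ bI K (TU U : Set (V ⊕ V)) (rAdd r v) := by
          have := sub_mem hxA (hIA hx2)
          simpa using this
        have : a • x - killHom K v (a • x) =
            a * (x - killHom K v x) + (a - killHom K v a) * killHom K v x := by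
          rw [smul_eq_mul, map_mul]; ring
        rw [this]
        exact add_mem (Ideal.mul_mem_left _ _ hx2) (hmul2 _ (killHom_sub K v a) _ hkA)
      | mem x hx =>
        rcases hx with ⟨t, ht, rfl⟩ | ⟨i, j, h, rfl⟩
        · rw [killHom_X]
          split_ifs
          · rw [sub_zero]; exact bI_X ht
          · rw [sub_self]; exact zero_mem _
        · by_cases hv : i = v ∨ j = v
          · have h0 : killHom K v (X (Sum.inl i) * X (Sum.inr j) - X (Sum.inl j) * X (Sum.inr i))
                = 0 := by
              rw [map_sub, map_mul, map_mul]
              simp only [killHom_X, Sum.elim_inl, Sum.elim_inr, id_eq]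
              rcases hv with rfl | rfl <;> simp
            rw [h0, sub_zero]
            rcases h with h | ⟨hne, hi, hj⟩
            · exact bI_f h
            · rcases hv with rfl | rfl
              · exact bI_f hj
              · exact bI_f (hs _ _ hi)
          · push Not at hv
            rw [map_sub, map_mul, map_mul]
            simp only [killHom_X, Sum.elim_inl, Sum.elim_inr, id_eq, hv.1, hv.2, if_false]
            rw [sub_self]; exact zero_mem _
    have := add_mem hdiff hπB
    simpa using this

theorem ohtani_sup (K : Type) [Field K] (U : Finset V) (r : V → V → Prop) (v : V) :
    bI K (TU U : Set (V ⊕ V)) (rAdd r v) ⊔ bI K (TU (insert v U) : Set (V ⊕ V)) (rDel r v) =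
      bI K (TU (insert v U) : Set (V ⊕ V)) (rDel (rAdd r v) v) := by
  have hT : ∀ t ∈ (TU U : Set (V ⊕ V)), t ∈ (TU (insert v U) : Set (V ⊕ V)) := by
    intro t ht
    simp only [TU, Finset.coe_filter, Set.mem_setOf_eq, Finset.mem_univ, true_and,
        Finset.mem_insert] at ht ⊢
    exact Or.inr ht
  apply le_antisymm
  · apply sup_le
    · apply bI_le
      · intro t ht
        exact bI_X (hT t ht)
      · intro i j h
        by_cases hi : i = v
        · subst hi
          exact sub_mem (Ideal.mul_mem_right _ _ (bI_X (by simp [TU_inl])))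
            (Ideal.mul_mem_left _ _ (bI_X (by simp [TU_inr])))
        by_cases hj : j = v
        · subst hj
          exact sub_mem (Ideal.mul_mem_left _ _ (bI_X (by simp [TU_inr])))
            (Ideal.mul_mem_right _ _ (bI_X (by simp [TU_inl])))
        exact bI_f ⟨h, hi, hj⟩
    · exact bI_le (fun t ht => bI_X ht) (fun i j h => bI_f ⟨Or.inl h.1, h.2⟩)
  · apply bI_le
    · intro t ht
      exact Ideal.mem_sup_right (bI_X ht)
    · intro i j h
      exact Ideal.mem_sup_left (bI_f h.1)

theorem count_clique (f : V → ℕ) (C : Finset V) (hC : ∀ i ∈ C, ∀ j ∈ C, f i = f j) :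
    C.card + (Finset.univ.image f).card ≤ Fintype.card V + 1 := by
  have h1 : (Finset.univ.image f) ⊆ C.image f ∪ (Cᶜ).image f := by
    rw [← Finset.image_union, Finset.union_compl]
  have h2 := Finset.card_le_card h1
  have h3 := Finset.card_union_le (C.image f) ((Cᶜ).image f)
  have h4 : (C.image f).card ≤ 1 := by
    rw [Finset.card_le_one]
    intro a ha b hb
    obtain ⟨i, hi, rfl⟩ := Finset.mem_image.1 ha
    obtain ⟨j, hj, rfl⟩ := Finset.mem_image.1 hb
    exact hC i hi j hj
  have h5 : ((Cᶜ).image f).card ≤ (Cᶜ).card := Finset.card_image_le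
  have h6 := Finset.card_add_card_compl C
  omega

theorem count_base (f : V → ℕ) (c : V → V) (hcc : ∀ i, c (c i) = c i) (hf : ∀ i, f (c i) = f i)
    (R C : Finset V) (hR : ∀ l ∈ R, ∃ g, c g = l ∧ g ≠ l)
    (hC : ∀ i ∈ C, ∀ j ∈ C, c i = c j) :
    R.card + C.card + (Finset.univ.image f).card ≤ Fintype.card V + 2 := by
  classical
  set Q := Finset.univ.image c with hQ
  have hQc : ∀ x ∈ Q, c x = x := by
    intro x hx
    obtain ⟨y, _, rfl⟩ := Finset.mem_image.1 hx
    exact hcc y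
  have h1 : (Finset.univ.image f).card ≤ Q.card := by
    have : Finset.univ.image f ⊆ Q.image f := by
      intro a ha
      obtain ⟨i, _, rfl⟩ := Finset.mem_image.1 ha
      exact Finset.mem_image.2 ⟨c i, Finset.mem_image_of_mem _ (Finset.mem_univ i), hf i⟩
    exact (Finset.card_le_card this).trans Finset.card_image_le
  have h2 : (C.image c).card ≤ 1 := by
    rw [Finset.card_le_one]
    intro a ha b hb
    obtain ⟨i, hi, rfl⟩ := Finset.mem_image.1 ha
    obtain ⟨j, hj, rfl⟩ := Finset.mem_image.1 hb
    exact hC i hi j hj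
  have h3 : C.card ≤ (C \ Q).card + 1 := by
    have e1 := Finset.card_inter_add_card_sdiff C Q
    have e2 : C ∩ Q ⊆ C.image c := by
      intro x hx
      rw [Finset.mem_inter] at hx
      exact Finset.mem_image.2 ⟨x, hx.1, hQc x hx.2⟩
    have := Finset.card_le_card e2
    omega
  have h4 : R.card ≤ (R \ C.image c).card + 1 := by
    have := Finset.le_card_sdiff (C.image c) R
    omega
  have hex : ∃ g : V → V, ∀ l ∈ R, c (g l) = l ∧ g l ≠ l := by
    have : ∀ l, ∃ g, l ∈ R → c g = l ∧ g ≠ l := by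
      intro l
      by_cases hl : l ∈ R
      · obtain ⟨g, hg⟩ := hR l hl
        exact ⟨g, fun _ => hg⟩
      · exact ⟨l, fun h => absurd h hl⟩
    choose g hg using this
    exact ⟨g, hg⟩
  obtain ⟨g, hg⟩ := hex
  have h5 : ((R \ C.image c).image g).card = (R \ C.image c).card := by
    apply Finset.card_image_of_injOn
    intro a ha b hb hab
    have ha' := (hg a (Finset.mem_sdiff.1 ha).1).1
    have hb' := (hg b (Finset.mem_sdiff.1 hb).1).1
    rw [← ha', ← hb', hab]
  have h6 : Disjoint (C \ Q) ((R \ C.image c).image g) := by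
    rw [Finset.disjoint_left]
    intro x hx hx2
    obtain ⟨l, hl, rfl⟩ := Finset.mem_image.1 hx2
    rw [Finset.mem_sdiff] at hl hx
    apply hl.2
    exact Finset.mem_image.2 ⟨g l, hx.1, (hg l hl.1).1⟩
  have h7 : (C \ Q) ∪ ((R \ C.image c).image g) ⊆ Qᶜ := by
    intro x hx
    rw [Finset.mem_compl]
    rcases Finset.mem_union.1 hx with hx | hx
    · exact (Finset.mem_sdiff.1 hx).2
    · obtain ⟨l, hl, rfl⟩ := Finset.mem_image.1 hx
      intro hq
      have e1 := hQc _ hq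
      have e2 := hg l (Finset.mem_sdiff.1 hl).1
      exact e2.2 (e1.symm.trans e2.1)
  have h8 := Finset.card_le_card h7
  rw [Finset.card_union_of_disjoint h6] at h8
  have h9 := Finset.card_add_card_compl Q
  omega

theorem count_update (f : V → ℕ) (v w : V) (hvw : w ≠ v) (hf : f w = f v) :
    ∃ f' : V → ℕ, (∀ i j, i ≠ v → j ≠ v → f i = f j → f' i = f' j) ∧
      (Finset.univ.image f).card + 1 ≤ (Finset.univ.image f').card := by
  obtain ⟨a, ha⟩ := Infinite.exists_notMem_finset (Finset.univ.image f)
  refine ⟨Function.update f v a, ?_, ?_⟩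
  · intro i j hi hj h
    simp [Function.update_of_ne hi, Function.update_of_ne hj, h]
  · rw [← Finset.card_insert_of_notMem ha]
    apply Finset.card_le_card
    intro x hx
    rcases Finset.mem_insert.1 hx with rfl | hx
    · exact Finset.mem_image.2 ⟨v, Finset.mem_univ _, by simp⟩
    · obtain ⟨i, _, rfl⟩ := Finset.mem_image.1 hx
      by_cases hi : i = v
      · subst hi
        exact Finset.mem_image.2 ⟨w, Finset.mem_univ _, by simp [Function.update_of_ne hvw, hf]⟩
      · exact Finset.mem_image.2 ⟨i, Finset.mem_univ _, by simp [Function.update_of_ne hi]⟩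

open Classical in
theorem main_ind (K : Type) [Field K] (k : Kos (V ⊕ V) K) (N : ℕ) :
    ∀ (M : ℕ) (U : Finset V) (r : V → V → Prop), (∀ i j, r i j → r j i) → (∀ i, ¬ r i i) →
      (∀ u ∈ U, ∀ w, ¬ r u w) → (Uᶜ).card ≤ N →
      (Finset.univ.filter (fun p : V × V => ¬ r p.1 p.2)).card ≤ M →
      ∀ (C : Finset V) (f : V → ℕ) (e : ℕ), (∀ i ∈ C, ∀ j ∈ C, i ≠ j → r i j) →
      (∀ i j, r i j → f i = f j) →
      Fintype.card V + 2 ≤ e + C.card + (Finset.univ.image f).card →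
      KReg k (bI K (TU U : Set (V ⊕ V)) r) e := by
  induction N with
  | zero =>
    intro M U r hs hi hU hN hM C f e hC hf he
    have hall : ∀ u, u ∈ U := by
      intro u
      by_contra h
      have := Finset.card_pos.2 ⟨u, Finset.mem_compl.2 h⟩
      omega
    have : bI K (TU U : Set (V ⊕ V)) r = bI K (TU U : Set (V ⊕ V)) (fun i j => id i = id j) := by
      apply bI_congr
      · intro i j h
        exact absurd h (hU i (hall i) j)
      · intro i j h
        obtain rfl : i = j := h
        rw [sub_self]; exact zero_mem _
    rw [this]
    exact base_case K k _ (TU U) id ∅ e le_rfl (fun a b hab h => absurd h hab)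
      (fun a b hab h => absurd h hab) (by simp)
  | succ N ihN =>
    intro M
    induction M with
    | zero =>
      intro U r hs hi hU hN hM C f e hC hf he
      have hemp : IsEmpty V := by
        constructor
        intro v
        have hm : (v, v) ∈ Finset.univ.filter (fun p : V × V => ¬ r p.1 p.2) := by simp [hi v]
        have := Finset.card_pos.2 ⟨_, hm⟩
        omega
      have : bI K (TU U : Set (V ⊕ V)) r = bI K (TU U : Set (V ⊕ V)) (fun i j => id i = id j) := by
        apply bI_congr
        · intro i; exact hemp.elim i
        · intro i; exact hemp.elim i
      rw [this]
      exact base_case K k _ (TU U) id ∅ e le_rfl (fun a b hab h => absurd h hab)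
        (fun a b hab h => absurd h hab) (by simp)
    | succ M ihM =>
      intro U r hs hi hU hN hM C f e hC hf he
      by_cases hv : ∃ v a b, r v a ∧ r v b ∧ a ≠ b ∧ ¬ r a b
      · obtain ⟨v, a, b, hva, hvb, hab, hnab⟩ := hv
        have hvU : v ∉ U := fun h => hU v h a hva
        have hcc := count_clique f C (by
          intro i hi j hj
          by_cases h : i = j
          · rw [h]
          · exact hf i j (hC i hi j hj h))
        obtain ⟨e, rfl⟩ : ∃ e', e = e' + 1 := ⟨e - 1, by omega⟩
        have hav : a ≠ v := by rintro rfl; exact hi _ hva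
        have hbv : b ≠ v := by rintro rfl; exact hi _ hvb
        obtain ⟨f', hf'1, hf'2⟩ := count_update f v a hav (hf _ _ hva).symm
        have hcardU : ((insert v U)ᶜ).card ≤ N := by
          have h1 := Finset.card_add_card_compl (insert v U)
          have h2 := Finset.card_add_card_compl U
          rw [Finset.card_insert_of_notMem hvU] at h1
          omega
        have hs1 : ∀ i j, rAdd r v i j → rAdd r v j i := by
          rintro i j (h | ⟨h1, h2, h3⟩)
          · exact Or.inl (hs _ _ h)
          · exact Or.inr ⟨h1.symm, h3, h2⟩
        have hi1 : ∀ i, ¬ rAdd r v i i := by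
          rintro i (h | ⟨h1, -⟩)
          · exact hi i h
          · exact h1 rfl
        have hf1 : ∀ i j, rAdd r v i j → f i = f j := by
          rintro i j (h | ⟨h1, h2, h3⟩)
          · exact hf _ _ h
          · rw [← hf _ _ h2, ← hf _ _ h3]
        have hU1 : ∀ u ∈ U, ∀ w, ¬ rAdd r v u w := by
          rintro u hu w (h | ⟨h1, h2, h3⟩)
          · exact hU u hu w h
          · exact hU u hu v (hs _ _ h2)
        rw [ohtani K U r hs v]
        apply KReg_inf k (bI_hom _ _) (bI_hom _ _)
        · apply ihM U (rAdd r v) hs1 hi1 hU1 hN _ C f (e + 1)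
            (fun i hi j hj hij => Or.inl (hC i hi j hj hij)) hf1 he
          have : (Finset.univ.filter (fun p : V × V => ¬ rAdd r v p.1 p.2)) ⊂
              (Finset.univ.filter (fun p : V × V => ¬ r p.1 p.2)) := by
            rw [Finset.ssubset_iff_of_subset]
            · refine ⟨(a, b), ?_, ?_⟩
              · simpa using hnab
              · simp only [Finset.mem_filter, Finset.mem_univ, true_and, not_not]
                exact Or.inr ⟨hab, hva, hvb⟩
            · intro p hp
              simp only [Finset.mem_filter, Finset.mem_univ, true_and] at hp ⊢
              exact fun h => hp (Or.inl h)
          have := Finset.card_lt_card this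
          omega
        · apply ihN _ (insert v U) (rDel r v) (fun i j h => ⟨hs _ _ h.1, h.2.2, h.2.1⟩)
            (fun i h => hi i h.1) _ hcardU le_rfl (C.erase v) f' (e + 1)
          · intro i hi j hj hij
            rw [Finset.mem_erase] at hi hj
            exact ⟨hC i hi.2 j hj.2 hij, hi.1, hj.1⟩
          · intro i j h
            exact hf'1 i j h.2.1 h.2.2 (hf _ _ h.1)
          · have := Finset.pred_card_le_card_erase (s := C) (a := v)
            omega
          · intro u hu w h
            rcases Finset.mem_insert.1 hu with rfl | hu
            · exact h.2.1 rfl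
            · exact hU u hu w h.1
        · rw [ohtani_sup]
          obtain ⟨C', hC'1, hC'2⟩ : ∃ C' : Finset V, C.card ≤ C'.card ∧
              ∀ i ∈ C', ∀ j ∈ C', i ≠ j → rDel (rAdd r v) v i j := by
            by_cases hvC : v ∈ C
            · obtain ⟨w, hvw, hwC⟩ : ∃ w, r v w ∧ w ∉ C := by
                by_contra hcon
                push Not at hcon
                exact hnab (hC a (hcon a hva) b (hcon b hvb) hab)
              have hwv : w ≠ v := by rintro rfl; exact hi _ hvw
              refine ⟨insert w (C.erase v), ?_, ?_⟩
              · rw [Finset.card_insert_of_notMem (by simp [hwC]), Finset.card_erase_of_mem hvC]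
                omega
              · have hn : ∀ i ∈ insert w (C.erase v), r v i ∧ i ≠ v := by
                  intro i hi
                  rcases Finset.mem_insert.1 hi with rfl | hi
                  · exact ⟨hvw, hwv⟩
                  · rw [Finset.mem_erase] at hi
                    exact ⟨hC v hvC i hi.2 hi.1.symm, hi.1⟩
                intro i hi j hj hij
                exact ⟨Or.inr ⟨hij, (hn i hi).1, (hn j hj).1⟩, (hn i hi).2, (hn j hj).2⟩
            · refine ⟨C, le_rfl, ?_⟩
              intro i hi j hj hij
              refine ⟨Or.inl (hC i hi j hj hij), ?_, ?_⟩
              · rintro rfl; exact hvC hi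
              · rintro rfl; exact hvC hj
          apply ihN _ (insert v U) (rDel (rAdd r v) v) (fun i j h => ⟨hs1 _ _ h.1, h.2.2, h.2.1⟩)
            (fun i h => hi1 i h.1) _ hcardU le_rfl C' f' e hC'2
          · intro i j h
            exact hf'1 i j h.2.1 h.2.2 (hf1 _ _ h.1)
          · omega
          · intro u hu w h
            rcases Finset.mem_insert.1 hu with rfl | hu
            · exact h.2.1 rfl
            · exact hU1 u hu w h.1
      · push Not at hv
        let s : Setoid V := ⟨fun i j => i = j ∨ r i j, by
          refine ⟨fun i => Or.inl rfl, ?_, ?_⟩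
          · rintro i j (rfl | h)
            · exact Or.inl rfl
            · exact Or.inr (hs _ _ h)
          · rintro i j l (rfl | h) (rfl | h')
            · exact Or.inl rfl
            · exact Or.inr h'
            · exact Or.inr h
            · by_cases hil : i = l
              · exact Or.inl hil
              · exact Or.inr (hv j i l (hs _ _ h) h' hil)⟩
        let c : V → V := fun i => (Quotient.mk s i).out
        have hc1 : ∀ i, c i = i ∨ r (c i) i := fun i => Quotient.mk_out (s := s) i
        have hc2 : ∀ i j, c i = c j ↔ (i = j ∨ r i j) := by
          intro i j
          constructor
          · intro h
            exact Quotient.exact (s := s) (Quotient.out_injective h)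
          · intro h
            have : Quotient.mk s i = Quotient.mk s j := Quotient.sound h
            simp only [c, this]
        have hbI : bI K (TU U : Set (V ⊕ V)) r = bI K (TU U : Set (V ⊕ V)) (fun i j => c i = c j) := by
          apply bI_congr
          · intro i j h
            exact bI_f ((hc2 i j).2 (Or.inr h))
          · intro i j h
            rcases (hc2 i j).1 h with rfl | h
            · rw [sub_self]; exact zero_mem _
            · exact bI_f h
        rw [hbI]
        apply base_case K k _ (TU U) c ((Finset.univ.filter (fun i => ∃ j, r i j)).image c) e le_rfl
        · intro i j hij hcij
          simp only [Finset.mem_coe, TU_inl, TU_inr]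
          tauto
        · intro i j hij hcij _ _ _ _
          refine Finset.mem_image_of_mem _ (Finset.mem_filter.2 ⟨Finset.mem_univ _, j, ?_⟩)
          exact ((hc2 i j).1 hcij).resolve_left hij
        · have := count_base f c (fun i => (hc2 _ _).2 (hc1 i)) (by
            intro i
            rcases hc1 i with h | h
            · rw [h]
            · exact hf _ _ h) ((Finset.univ.filter (fun i => ∃ j, r i j)).image c) C (by
            intro l hl
            obtain ⟨i, hi2, rfl⟩ := Finset.mem_image.1 hl
            obtain ⟨-, j, hij⟩ := Finset.mem_filter.1 hi2
            by_cases h : i = c i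
            · refine ⟨j, ((hc2 i j).2 (Or.inr hij)).symm, ?_⟩
              rw [← h]
              rintro rfl
              exact hi _ hij
            · exact ⟨i, rfl, h⟩) (by
            intro i hi j hj
            rw [hc2]
            by_cases h : i = j
            · exact Or.inl h
            · exact Or.inr (hC i hi j hj h))
          omega

end main

/-- **An upper bound for the regularity of binomial edge ideals via the clique
complex.**  For a connected graph `G` on `[n]`,
`reg (S/J_G) ≤ n - dim Δ(G)`. -/
theorem reg_quotient_binomialEdgeIdeal_le_sub_dim_cliqueComplex
    (K : Type) [Field K] (n : ℕ) (G : SimpleGraph (Fin n))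
    (hconn : G.Connected)
    (F : MinimalGradedFreeResolutionOfQuotient (binomialEdgeIdeal K G)) :
    F.reg ≤ n - dimCliqueComplex G := by
  classical
  obtain ⟨k⟩ := kos_exists (Fin n ⊕ Fin n) K
  obtain ⟨v0⟩ := hconn.nonempty
  have hbdd : BddAbove {d : ℕ | ∃ C : Finset (Fin n), G.IsClique ↑C ∧ C.card = d + 1} := by
    refine ⟨n, ?_⟩
    rintro d ⟨C, -, hC⟩
    have := Finset.card_le_univ C
    simp at this
    omega
  have hne : {d : ℕ | ∃ C : Finset (Fin n), G.IsClique ↑C ∧ C.card = d + 1}.Nonempty :=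
    ⟨0, {v0}, by simp, by simp⟩
  obtain ⟨C, hC, hCc⟩ := Nat.sSup_mem hne hbdd
  change C.card = dimCliqueComplex G + 1 at hCc
  have hCn := Finset.card_le_univ C
  simp only [Fintype.card_fin] at hCn
  have hideal : binomialEdgeIdeal K G = bI K (TU (∅ : Finset (Fin n)) : Set (Fin n ⊕ Fin n)) G.Adj := by
    unfold binomialEdgeIdeal bI
    congr 1
    have : (TU (∅ : Finset (Fin n)) : Set (Fin n ⊕ Fin n)) = ∅ := by
      ext t; simp [TU]
    rw [this]
    simp
  have hreg : ∀ e, n - dimCliqueComplex G ≤ e → KReg k (binomialEdgeIdeal K G) e := by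
    intro e he
    rw [hideal]
    apply main_ind K k _ _ ∅ G.Adj (fun i j h => h.symm) (fun i => G.irrefl) (by simp) le_rfl le_rfl
      C (fun _ => 0) e (fun i hi j hj hij => hC hi hj hij) (fun _ _ _ => rfl)
    have : (Finset.univ.image (fun _ : Fin n => 0)).card = 1 := by
      rw [Finset.card_eq_one]
      refine ⟨0, ?_⟩
      ext x
      simp only [Finset.mem_image, Finset.mem_univ, true_and, Finset.mem_singleton]
      exact ⟨fun ⟨_, h⟩ => h.symm, fun h => ⟨v0, h.symm⟩⟩
    rw [this, Fintype.card_fin]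
    omega
  unfold MinimalGradedFreeResolutionOfQuotient.reg
  apply csSup_le'
  rintro d ⟨i, t, hd⟩
  by_contra hlt
  push Not at hlt
  obtain ⟨e, rfl⟩ : ∃ e, d = e + 1 := ⟨d - 1, by omega⟩
  exact twist_ne F k e (KReg_bot K k) (hreg e (by omega)) i t hd

end
end
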